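/- arXiv:1309.7247 — 2 statements merged into one kernel-verified Lean document; each statement's English description precedes it below -/
import Mathlib

section
/- For the Rogers-Ramanujan continued fraction R(q) with 0 < q < 1, the identity R(q)⁻⁵ − 11 − R(q)⁵ = f(−q)⁶ / (q · f(−q⁵)⁶) holds, where f(−q) = ∏_{n≥1}(1 − qⁿ). -/
/-- Ramanujan's eta function `f(-q) = ∏_{n ≥ 1} (1 - qⁿ)`. -/
noncomputable def ramanujanF (q : ℝ) : ℝ := ∏' n : ℕ, (1 - q ^ (n + 1))

/-- The Rogers–Ramanujan continued fraction, via its product formula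
`R(q) = q^(1/5) ∏_{n ≥ 1} (1 - qⁿ)^(n|5)` with `(n|5)` the Legendre symbol. -/
noncomputable def rogersRamanujan (q : ℝ) : ℝ :=
  haveI : Fact (Nat.Prime 5) := ⟨by norm_num⟩
  q ^ ((1 : ℝ) / 5) * ∏' n : ℕ, (1 - q ^ (n + 1)) ^ (legendreSym 5 (n + 1))

/-- An infinite product splits along a finite partition of the index type into injective images. -/
@[to_additive]
theorem hasProd_of_partition {M ι β γ : Type*} [CommMonoid M] [TopologicalSpace M]
    [ContinuousMul M] [Fintype ι] {f : γ → M} {a : ι → M} (e : ι → β → γ)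
    (hinj : ∀ i, Function.Injective (e i))
    (hdisj : ∀ i j m n, e i m = e j n → i = j) (hcover : ∀ c, ∃ i m, e i m = c)
    (h : ∀ i, HasProd (fun m => f (e i m)) (a i)) : HasProd f (∏ i, a i) := by
  have h1 := hasProd_prod_disjoint (f := f) (a := a) Finset.univ (t := fun i => Set.range (e i))
    (fun i _ j _ hij => by
      rw [Function.onFun, Set.disjoint_left]
      rintro _ ⟨m, rfl⟩ ⟨n, hn⟩
      exact hij (hdisj _ _ _ _ hn).symm)
    (fun i _ => ((hinj i).hasProd_range_iff (f := f)).2 (h i))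
  have hU : (⋃ i ∈ (Finset.univ : Finset ι), Set.range (e i)) = Set.univ := by
    ext c
    obtain ⟨i, m, rfl⟩ := hcover c
    simp
  rw [hU] at h1
  exact (Equiv.Set.univ γ).hasProd_iff.1 h1

theorem hasProd_of_mod_five {M : Type*} [CommMonoid M] [TopologicalSpace M]
    [ContinuousMul M] {f : ℕ → M} {a : Fin 5 → M}
    (h : ∀ i : Fin 5, HasProd (fun m => f (5 * m + i)) (a i)) : HasProd f (∏ i, a i) :=
  hasProd_of_partition (fun i m => 5 * m + (i : ℕ)) (fun i m n hmn => by dsimp at hmn; omega)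
    (fun i j m n hmn => by ext; omega)
    (fun c => ⟨⟨c % 5, by omega⟩, c / 5, by dsimp; omega⟩) h

theorem hasSum_of_int_mod_five {M : Type*} [AddCommMonoid M] [TopologicalSpace M]
    [ContinuousAdd M] {f : ℤ → M} {a : Fin 5 → M}
    (h : ∀ i : Fin 5, HasSum (fun m : ℤ => f (5 * m + ((i : ℕ) - 1 : ℤ))) (a i)) :
    HasSum f (∑ i, a i) :=
  hasSum_of_partition (fun (i : Fin 5) (m : ℤ) => 5 * m + ((i : ℕ) - 1 : ℤ))
    (fun i m n hmn => by dsimp at hmn; omega)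
    (fun i j m n hmn => by ext; omega)
    (fun c => ⟨⟨((c + 1) % 5).toNat, by omega⟩, (c + 1) / 5, by dsimp; omega⟩) h

/-- The infinite `q`-Pochhammer symbol `∏_{n ≥ 0} (1 - x qⁿ)`. -/
noncomputable def qPochhammer (x q : ℂ) : ℂ := ∏' n : ℕ, (1 - x * q ^ n)

section qPochhammer

variable {q : ℂ}

theorem summable_norm_neg_mul_pow (x : ℂ) (hq : ‖q‖ < 1) :
    Summable fun n : ℕ => ‖-(x * q ^ n)‖ := by
  simpa using (summable_geometric_of_lt_one (norm_nonneg q) hq).mul_left ‖x‖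

theorem hasProd_qPochhammer (x : ℂ) (hq : ‖q‖ < 1) :
    HasProd (fun n : ℕ => 1 - x * q ^ n) (qPochhammer x q) := by
  have h := multipliable_one_add_of_summable (summable_norm_neg_mul_pow x hq)
  simpa [sub_eq_add_neg, qPochhammer] using! h.hasProd

theorem qPochhammer_ne_zero {x : ℂ} (hx : ∀ n : ℕ, x * q ^ n ≠ 1) (hq : ‖q‖ < 1) :
    qPochhammer x q ≠ 0 := by
  have h := tprod_one_add_ne_zero_of_summable (f := fun n : ℕ => -(x * q ^ n))
    (fun n => by rw [← sub_eq_add_neg, sub_ne_zero]; exact (hx n).symm)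
    (summable_norm_neg_mul_pow x hq)
  simpa [sub_eq_add_neg, qPochhammer] using! h

theorem mul_pow_ne_one {x : ℂ} (hx : ‖x‖ < 1) (hq : ‖q‖ < 1) (n : ℕ) : x * q ^ n ≠ 1 := by
  intro h
  have h1 : ‖x * q ^ n‖ < 1 := by
    rw [norm_mul, norm_pow]
    exact mul_lt_one_of_nonneg_of_lt_one_left (norm_nonneg x) hx
      (pow_le_one₀ (norm_nonneg q) hq.le)
  simp [h] at h1

theorem qPochhammer_eq_one_sub_mul (x : ℂ) (hq : ‖q‖ < 1) :
    qPochhammer x q = (1 - x) * qPochhammer (x * q) q := by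
  have h := (hasProd_qPochhammer (x * q) hq)
  have h2 := HasProd.zero_mul (f := fun n : ℕ => 1 - x * q ^ n) (m := qPochhammer (x * q) q)
    (by convert h using 2 with n; ring)
  simpa using (hasProd_qPochhammer x hq).unique h2

theorem qPochhammer_one (hq : ‖q‖ < 1) : qPochhammer 1 q = 0 := by
  simp [qPochhammer_eq_one_sub_mul 1 hq]

end qPochhammer

/-- The general term of the Jacobi theta series `∑ (-1)ʲ zʲ q^(j(j-1)/2)`. -/
noncomputable def thetaTerm (z q : ℂ) (j : ℤ) : ℂ := (-1) ^ j * z ^ j * q ^ (j * (j - 1) / 2)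

section thetaTerm

variable {z q : ℂ}

theorem thetaTerm_succ (hz : z ≠ 0) (hq : q ≠ 0) (j : ℤ) :
    thetaTerm z q (j + 1) = -z * q ^ j * thetaTerm z q j := by
  have h : (j + 1) * (j + 1 - 1) / 2 = j + j * (j - 1) / 2 := by
    rw [show (j + 1) * (j + 1 - 1) = j * (j - 1) + j * 2 by ring,
      Int.add_mul_ediv_right _ _ two_ne_zero, add_comm]
  rw [thetaTerm, thetaTerm, h, zpow_add₀ hq, zpow_add_one₀ hz,
    zpow_add_one₀ (neg_ne_zero.2 one_ne_zero)]
  ring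

theorem thetaTerm_ne_zero (hz : z ≠ 0) (hq : q ≠ 0) (j : ℤ) : thetaTerm z q j ≠ 0 := by
  simp [thetaTerm, zpow_ne_zero, hz, hq]

theorem summable_thetaTerm (hz : z ≠ 0) (hq : q ≠ 0) (hq1 : ‖q‖ < 1) :
    Summable (thetaTerm z q) := by
  have hpow := tendsto_pow_atTop_nhds_zero_of_lt_one (norm_nonneg q) hq1
  apply Summable.of_nat_of_neg
  · refine summable_of_ratio_test_tendsto_lt_one zero_lt_one
      (.of_forall fun n => thetaTerm_ne_zero hz hq n) ?_
    have h : ∀ n : ℕ, ‖thetaTerm z q ((n + 1 : ℕ) : ℤ)‖ / ‖thetaTerm z q n‖ = ‖z‖ * ‖q‖ ^ n := by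
      intro n
      rw [div_eq_iff (norm_ne_zero_iff.2 (thetaTerm_ne_zero hz hq _))]
      push_cast
      rw [thetaTerm_succ hz hq]
      simp
    simp_rw [h]
    simpa using hpow.const_mul ‖z‖
  · refine summable_of_ratio_test_tendsto_lt_one zero_lt_one
      (.of_forall fun n => thetaTerm_ne_zero hz hq (-n)) ?_
    have h : ∀ n : ℕ, ‖thetaTerm z q (-((n + 1 : ℕ) : ℤ))‖ / ‖thetaTerm z q (-n)‖ =
        ‖z‖⁻¹ * ‖q‖ ^ (n + 1) := by
      intro n
      have h1 := thetaTerm_succ hz hq (-((n + 1 : ℕ) : ℤ))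
      rw [show -((n + 1 : ℕ) : ℤ) + 1 = -n by push_cast; ring] at h1
      rw [div_eq_iff (norm_ne_zero_iff.2 (thetaTerm_ne_zero hz hq _)), h1]
      have := norm_ne_zero_iff.2 hz
      have := norm_ne_zero_iff.2 hq
      rw [zpow_neg, zpow_natCast]
      simp only [norm_mul, norm_neg, norm_inv, norm_pow]
      field_simp
    simp_rw [h]
    simpa using (hpow.comp (Filter.tendsto_add_atTop_nat 1)).const_mul ‖z‖⁻¹

end thetaTerm

/-- The reciprocal of the finite product `∏_{i < m} (1 - q^(i+1))`, extended by zero to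
negative `m`. -/
noncomputable def qFactorialInv (q : ℂ) (m : ℤ) : ℂ :=
  if m < 0 then 0 else (∏ i ∈ Finset.range m.toNat, (1 - q ^ (i + 1)))⁻¹

section qFactorialInv

variable {q : ℂ}

theorem one_sub_pow_succ_ne_zero (hq : ‖q‖ < 1) (n : ℕ) : 1 - q ^ (n + 1) ≠ 0 := by
  have := mul_pow_ne_one hq hq n
  rw [← pow_succ'] at this
  exact sub_ne_zero.2 this.symm

theorem qFactorialInv_sub_one (hq : ‖q‖ < 1) (m : ℤ) :
    qFactorialInv q (m - 1) = (1 - q ^ m) * qFactorialInv q m := by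
  rcases lt_trichotomy m 0 with h | rfl | h
  · simp [qFactorialInv, h, show m - 1 < 0 by omega]
  · simp [qFactorialInv]
  · obtain ⟨n, rfl⟩ : ∃ n : ℕ, m = n + 1 := ⟨(m - 1).toNat, by omega⟩
    have h2 := one_sub_pow_succ_ne_zero hq n
    have h3 : ((n : ℤ) + 1).toNat = n + 1 := by omega
    have h4 : q ^ ((n : ℤ) + 1) = q ^ (n + 1) := by exact_mod_cast zpow_natCast q (n + 1)
    simp only [qFactorialInv, add_sub_cancel_right, h3, h4, Finset.prod_range_succ]
    rw [if_neg (by omega), if_neg (by omega), mul_inv, Int.toNat_natCast]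
    field_simp

theorem tendsto_prod_one_sub_pow (hq : ‖q‖ < 1) :
    Filter.Tendsto (fun n : ℕ => ∏ i ∈ Finset.range n, (1 - q ^ (i + 1))) Filter.atTop
      (nhds (qPochhammer q q)) := by
  simpa [pow_succ'] using (hasProd_qPochhammer q hq).tendsto_prod_nat

theorem qPochhammer_self_ne_zero (hq : ‖q‖ < 1) : qPochhammer q q ≠ 0 :=
  qPochhammer_ne_zero (mul_pow_ne_one hq hq) hq

theorem tendsto_qFactorialInv (hq : ‖q‖ < 1) :
    Filter.Tendsto (qFactorialInv q) Filter.atTop (nhds (qPochhammer q q)⁻¹) := by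
  have h : Filter.Tendsto Int.toNat Filter.atTop Filter.atTop :=
    Filter.tendsto_atTop.2 fun n => (Filter.eventually_ge_atTop (n : ℤ)).mono fun m hm => by omega
  refine (((tendsto_prod_one_sub_pow hq).inv₀ (qPochhammer_self_ne_zero hq)).comp h).congr' ?_
  filter_upwards [Filter.eventually_ge_atTop 0] with m hm
  simp [qFactorialInv, hm.not_gt]

theorem exists_norm_le_of_tendsto {u : ℕ → ℂ} {a : ℂ} (h : Filter.Tendsto u Filter.atTop (nhds a)) :
    ∃ C, 0 ≤ C ∧ ∀ n, ‖u n‖ ≤ C := by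
  obtain ⟨C, hC⟩ := (Metric.isBounded_range_of_tendsto u h).exists_norm_le
  exact ⟨C, (norm_nonneg _).trans (hC _ ⟨0, rfl⟩), fun n => hC _ ⟨n, rfl⟩⟩

theorem exists_norm_qFactorialInv_le (hq : ‖q‖ < 1) :
    ∃ C, 0 ≤ C ∧ ∀ m, ‖qFactorialInv q m‖ ≤ C := by
  obtain ⟨C, hC0, hC⟩ := exists_norm_le_of_tendsto
    ((tendsto_prod_one_sub_pow hq).inv₀ (qPochhammer_self_ne_zero hq))
  refine ⟨C, hC0, fun m => ?_⟩
  unfold qFactorialInv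
  split_ifs
  · simpa
  · exact hC _

/-- A finite form of the Jacobi triple product identity. -/
theorem hasSum_finite_jacobi_triple_product {z : ℂ} (hz : z ≠ 0) (hq0 : q ≠ 0) (hq : ‖q‖ < 1)
    (n : ℕ) :
    HasSum (fun j : ℤ => thetaTerm z q j * ((∏ i ∈ Finset.range (2 * n), (1 - q ^ (i + 1))) *
      qFactorialInv q (n - j) * qFactorialInv q (n + j)))
      ((∏ i ∈ Finset.range n, (1 - z * q ^ i)) * ∏ i ∈ Finset.range n, (1 - q / z * q ^ i)) := by
  induction n with
  | zero =>
    convert hasSum_single (0 : ℤ) ?_ using 1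
    · simp [thetaTerm, qFactorialInv]
    · intro j hj
      rcases hj.lt_or_gt with h | h <;> simp [qFactorialInv, h]
  | succ n ih =>
    have hs := (Equiv.subRight (1 : ℤ)).hasSum_iff.2 ih
    have ha := (Equiv.addRight (1 : ℤ)).hasSum_iff.2 ih
    have h := ((ih.mul_left (1 + q ^ (2 * n + 1))).add (hs.mul_left (-(z * q ^ n)))).add
      (ha.mul_left (-(q ^ (n + 1) / z)))
    convert! h using 1
    · funext j
      have e1 : thetaTerm z q j = -z * (q ^ j / q) * thetaTerm z q (j - 1) := by
        have := thetaTerm_succ hz hq0 (j - 1)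
        rwa [sub_add_cancel, zpow_sub_one₀ hq0, ← div_eq_mul_inv] at this
      have e2 := thetaTerm_succ hz hq0 j
      have hj : q ^ j ≠ 0 := zpow_ne_zero _ hq0
      have hn : q ^ n ≠ 0 := pow_ne_zero _ hq0
      have f1 := qFactorialInv_sub_one hq (n + 1 - j)
      have f2 := qFactorialInv_sub_one hq (n + 1 + j)
      have f3 := qFactorialInv_sub_one hq (n - j)
      have f4 := qFactorialInv_sub_one hq (n + j)
      rw [show (n : ℤ) + 1 - j - 1 = n - j by ring] at f1
      rw [show (n : ℤ) + 1 + j - 1 = n + j by ring] at f2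
      have g1 : q ^ ((n : ℤ) + 1 - j) = q ^ n * q / q ^ j := by
        rw [zpow_sub₀ hq0, zpow_add_one₀ hq0, zpow_natCast]
      have g2 : q ^ ((n : ℤ) + 1 + j) = q ^ n * q * q ^ j := by
        rw [zpow_add₀ hq0, zpow_add_one₀ hq0, zpow_natCast]
      have g3 : q ^ ((n : ℤ) - j) = q ^ n / q ^ j := by
        rw [zpow_sub₀ hq0, zpow_natCast]
      have g4 : q ^ ((n : ℤ) + j) = q ^ n * q ^ j := by
        rw [zpow_add₀ hq0, zpow_natCast]
      have hP : ∏ i ∈ Finset.range (2 * (n + 1)), (1 - q ^ (i + 1)) =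
          (∏ i ∈ Finset.range (2 * n), (1 - q ^ (i + 1))) * (1 - (q ^ n) ^ 2 * q) *
            (1 - (q ^ n) ^ 2 * q ^ 2) := by
        rw [show 2 * (n + 1) = 2 * n + 1 + 1 by ring, Finset.prod_range_succ,
          Finset.prod_range_succ]
        ring
      have c1 : ((n + 1 : ℕ) : ℤ) = n + 1 := by push_cast; ring
      simp only [Function.comp_apply, Equiv.subRight_apply, Equiv.coe_addRight]
      rw [c1, hP, show (n : ℤ) - (j - 1) = n + 1 - j by ring,
        show (n : ℤ) + (j - 1) = n + j - 1 by ring,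
        show (n : ℤ) - (j + 1) = n - j - 1 by ring,
        show (n : ℤ) + (j + 1) = n + 1 + j by ring, f3, f4, f1, f2, g1, g2, g3, g4, e2, e1,
        show q ^ (2 * n + 1) = (q ^ n) ^ 2 * q by ring, pow_succ q n]
      generalize qFactorialInv q (n + 1 - j) = A
      generalize qFactorialInv q (n + 1 + j) = B
      generalize thetaTerm z q (j - 1) = T
      generalize ∏ i ∈ Finset.range (2 * n), (1 - q ^ (i + 1)) = P
      generalize q ^ j = Y at *
      generalize q ^ n = X at *
      field_simp
      ring
    · rw [Finset.prod_range_succ, Finset.prod_range_succ]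
      field_simp
      ring

/-- The **Jacobi triple product identity**. -/
theorem hasSum_jacobi_triple_product {z : ℂ} (hz : z ≠ 0) (hq0 : q ≠ 0) (hq : ‖q‖ < 1) :
    HasSum (thetaTerm z q)
      (qPochhammer q q * qPochhammer z q * qPochhammer (q / z) q) := by
  obtain ⟨C, hC0, hC⟩ := exists_norm_qFactorialInv_le hq
  obtain ⟨D, hD0, hD⟩ := exists_norm_le_of_tendsto (tendsto_prod_one_sub_pow hq)
  have hE := qPochhammer_self_ne_zero hq
  have hs := summable_thetaTerm hz hq0 hq
  have hlim := tendsto_tsum_of_dominated_convergence (𝓕 := Filter.atTop)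
    (f := fun (n : ℕ) (j : ℤ) => thetaTerm z q j *
      ((∏ i ∈ Finset.range (2 * n), (1 - q ^ (i + 1))) *
      qFactorialInv q (n - j) * qFactorialInv q (n + j)))
    (g := fun j => thetaTerm z q j *
      (qPochhammer q q * (qPochhammer q q)⁻¹ * (qPochhammer q q)⁻¹))
    (bound := fun j => ‖thetaTerm z q j‖ * (D * C * C)) (hs.norm.mul_right _)
    (fun j => by
      have t1 := (tendsto_prod_one_sub_pow hq).comp
        (Filter.tendsto_id.const_mul_atTop' (two_pos : 0 < 2))
      have t2 : Filter.Tendsto (fun n : ℕ => (n : ℤ) - j) Filter.atTop Filter.atTop :=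
        Filter.tendsto_atTop_add_const_right _ _ tendsto_natCast_atTop_atTop
      have t3 : Filter.Tendsto (fun n : ℕ => (n : ℤ) + j) Filter.atTop Filter.atTop :=
        Filter.tendsto_atTop_add_const_right _ _ tendsto_natCast_atTop_atTop
      exact ((t1.mul ((tendsto_qFactorialInv hq).comp t2)).mul
        ((tendsto_qFactorialInv hq).comp t3)).const_mul _)
    (.of_forall fun n j => by
      rw [norm_mul, norm_mul, norm_mul]
      gcongr
      exacts [hD _, hC _, hC _])
  simp_rw [(hasSum_finite_jacobi_triple_product hz hq0 hq _).tsum_eq] at hlim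
  have hprod := ((hasProd_qPochhammer z hq).tendsto_prod_nat).mul
    ((hasProd_qPochhammer (q / z) hq).tendsto_prod_nat)
  have h := tendsto_nhds_unique hprod hlim
  rw [tsum_mul_right, mul_inv_cancel₀ hE, one_mul] at h
  have h2 : ∑' j, thetaTerm z q j =
      qPochhammer q q * qPochhammer z q * qPochhammer (q / z) q := by
    rw [mul_assoc, h]
    field_simp
  exact h2 ▸ hs.hasSum

end qFactorialInv

theorem prod_sub_root_of_unity_mul {K : Type*} [Field K] {w : K}
    (hw : 1 + w + w ^ 2 + w ^ 3 + w ^ 4 = 0) (x y : K) :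
    (x - y) * (x - w * y) * (x - w ^ 2 * y) * (x - w ^ 3 * y) * (x - w ^ 4 * y) =
      x ^ 5 - y ^ 5 := by
  grind

section Dissection

variable {t w : ℂ}

theorem prod_qPochhammer_root_of_unity (hw : 1 + w + w ^ 2 + w ^ 3 + w ^ 4 = 0) (ht : ‖t‖ < 1) :
    qPochhammer t t * qPochhammer (w * t) t * qPochhammer (w ^ 2 * t) t *
      qPochhammer (w ^ 3 * t) t * qPochhammer (w ^ 4 * t) t = qPochhammer (t ^ 5) (t ^ 5) := by
  have ht5 : ‖t ^ 5‖ < 1 := by simpa using pow_lt_one₀ (norm_nonneg t) ht (by norm_num)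
  have h := ((((hasProd_qPochhammer t ht).mul (hasProd_qPochhammer (w * t) ht)).mul
    (hasProd_qPochhammer (w ^ 2 * t) ht)).mul (hasProd_qPochhammer (w ^ 3 * t) ht)).mul
    (hasProd_qPochhammer (w ^ 4 * t) ht)
  refine h.unique ?_
  convert hasProd_qPochhammer (t ^ 5) ht5 using 2 with n
  have := prod_sub_root_of_unity_mul hw 1 (t * t ^ n)
  simp only [← mul_assoc] at this
  rw [this]
  ring

/-- The product `(q; q)_∞` splits along residue classes modulo five. -/
theorem qPochhammer_self_eq_prod {q : ℂ} (hq : ‖q‖ < 1) :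
    qPochhammer q q = ∏ i : Fin 5, qPochhammer (q ^ (i + 1 : ℕ)) (q ^ 5) := by
  have hq5 : ‖q ^ 5‖ < 1 := by simpa using pow_lt_one₀ (norm_nonneg q) hq (by norm_num)
  refine (hasProd_qPochhammer q hq).unique (hasProd_of_mod_five fun i => ?_)
  convert hasProd_qPochhammer (q ^ (i + 1 : ℕ)) hq5 using 2 with n
  ring

/-- The theta product `(q⁵; q⁵)_∞ (x; q⁵)_∞ (q⁵/x; q⁵)_∞` with `x = q`. -/
noncomputable def thetaOne (q : ℂ) : ℂ :=
  qPochhammer (q ^ 5) (q ^ 5) * qPochhammer q (q ^ 5) * qPochhammer (q ^ 4) (q ^ 5)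

/-- The theta product `(q⁵; q⁵)_∞ (x; q⁵)_∞ (q⁵/x; q⁵)_∞` with `x = q²`. -/
noncomputable def thetaTwo (q : ℂ) : ℂ :=
  qPochhammer (q ^ 5) (q ^ 5) * qPochhammer (q ^ 2) (q ^ 5) * qPochhammer (q ^ 3) (q ^ 5)

theorem thetaOne_mul_thetaTwo {q : ℂ} (hq : ‖q‖ < 1) :
    thetaOne q * thetaTwo q = qPochhammer q q * qPochhammer (q ^ 5) (q ^ 5) := by
  rw [qPochhammer_self_eq_prod hq, thetaOne, thetaTwo]
  simp [Fin.prod_univ_five]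
  ring

theorem thetaTerm_five_mul_add {z : ℂ} (hz : z ^ 5 = 1) (ht : t ≠ 0) {c e : ℤ}
    (he : c * (c - 1) = 2 * e) (m : ℤ) :
    thetaTerm z t (5 * m + c) =
      (-1) ^ c * z ^ c * t ^ e * thetaTerm (t ^ (10 + 5 * c)) (t ^ (25 : ℤ)) m := by
  have hz0 : z ≠ 0 := by rintro rfl; norm_num at hz
  obtain ⟨k, hk⟩ := Int.even_mul_pred_self m
  have h1 : m * (m - 1) / 2 = k := by omega
  have h2 : (5 * m + c) * (5 * m + c - 1) / 2 = e + ((10 + 5 * c) * m + 25 * k) := by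
    rw [show (5 * m + c) * (5 * m + c - 1) = 2 * (e + ((10 + 5 * c) * m + 25 * k)) by
      linear_combination 25 * hk + he]
    omega
  have hz5 : z ^ (5 : ℤ) = 1 := by exact_mod_cast hz
  have hm5 : (-1 : ℂ) ^ (5 : ℤ) = -1 := by norm_num
  rw [thetaTerm, thetaTerm, h1, h2, zpow_add₀ (neg_ne_zero.2 one_ne_zero), zpow_add₀ hz0,
    zpow_add₀ ht, zpow_add₀ ht, zpow_mul, zpow_mul, zpow_mul, zpow_mul, hz5, hm5, one_zpow]
  ring

theorem hasSum_thetaTerm_five_mul_add {z : ℂ} (hz : z ^ 5 = 1) (ht0 : t ≠ 0) (ht : ‖t‖ < 1)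
    {c e : ℤ} (he : c * (c - 1) = 2 * e) :
    HasSum (fun m => thetaTerm z t (5 * m + c)) ((-1) ^ c * z ^ c * t ^ e *
      (qPochhammer ((t ^ 5) ^ 5) ((t ^ 5) ^ 5) *
        qPochhammer ((t ^ 5) ^ (2 + c)) ((t ^ 5) ^ 5) *
        qPochhammer ((t ^ 5) ^ (3 - c)) ((t ^ 5) ^ 5))) := by
  have ht5 : ‖(t ^ 5) ^ 5‖ < 1 := by
    simpa [← pow_mul] using pow_lt_one₀ (norm_nonneg t) ht (by norm_num)
  have h0 : t ^ 5 ≠ 0 := pow_ne_zero _ ht0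
  have h := (hasSum_jacobi_triple_product (zpow_ne_zero (2 + c) h0)
    (pow_ne_zero 5 h0) ht5).mul_left ((-1) ^ c * z ^ c * t ^ e)
  have e1 : (t ^ 5) ^ 5 / (t ^ 5) ^ (2 + c) = (t ^ 5) ^ (3 - c) := by
    rw [div_eq_iff (zpow_ne_zero _ h0), ← zpow_add₀ h0, ← zpow_natCast]
    congr 1
    push_cast
    ring
  have e2 : (t ^ 5) ^ (2 + c) = t ^ (10 + 5 * c) := by
    rw [← zpow_natCast, ← zpow_mul]
    congr 1
    push_cast
    ring
  have e3 : (t ^ 5) ^ 5 = t ^ (25 : ℤ) := by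
    rw [← pow_mul]
    norm_cast
  rw [e1] at h
  simp_rw [thetaTerm_five_mul_add hz ht0 he, ← e2, ← e3]
  exact h

/-- The five-dissection of the theta series at a fifth root of unity. -/
theorem tsum_thetaTerm_root_of_unity {z : ℂ} (hz : z ^ 5 = 1) (ht0 : t ≠ 0) (ht : ‖t‖ < 1) :
    ∑' j, thetaTerm z t j =
      (1 - z) * thetaTwo (t ^ 5) + t * (z ^ 2 - z ^ 4) * thetaOne (t ^ 5) := by
  have hz0 : z ≠ 0 := by rintro rfl; norm_num at hz
  have ht5 : ‖(t ^ 5) ^ 5‖ < 1 := by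
    simpa [← pow_mul] using pow_lt_one₀ (norm_nonneg t) ht (by norm_num)
  have hzi : z⁻¹ = z ^ 4 := by
    rw [inv_eq_one_div, div_eq_iff hz0, ← hz]
    ring
  have h := hasSum_of_int_mod_five (f := thetaTerm z t) fun i : Fin 5 =>
    hasSum_thetaTerm_five_mul_add hz ht0 ht (c := ((i : ℕ) - 1 : ℤ))
      (e := ![1, 0, 0, 1, 3] i) (by fin_cases i <;> rfl)
  rw [h.tsum_eq, Fin.sum_univ_five]
  simp only [thetaOne, thetaTwo]
  have v2 : (![1, 0, 0, 1, 3] : Fin 5 → ℤ) 2 = 0 := rfl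
  have v3 : (![1, 0, 0, 1, 3] : Fin 5 → ℤ) 3 = 1 := rfl
  norm_num [qPochhammer_one ht5, hzi, zpow_ofNat, v2, v3]
  ring

theorem qPochhammer_mul_qPochhammer_pow_five (hw : 1 + w + w ^ 2 + w ^ 3 + w ^ 4 = 0)
    (ht0 : t ≠ 0) (ht : ‖t‖ < 1) :
    qPochhammer t t * qPochhammer (t ^ 5) (t ^ 5) =
      thetaTwo (t ^ 5) ^ 2 - t * thetaOne (t ^ 5) * thetaTwo (t ^ 5) -
        t ^ 2 * thetaOne (t ^ 5) ^ 2 := by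
  have hw5 : w ^ 5 = 1 := by linear_combination (w - 1) * hw
  have hw1 : 1 - w ≠ 0 := by
    intro h
    rw [← sub_eq_zero.1 h] at hw
    norm_num at hw
  have hw2 : 1 - w ^ 2 ≠ 0 := by
    intro h
    apply hw1
    linear_combination -hw5 - w * (w ^ 2 + 1) * h
  have key : ∀ z : ℂ, z ^ 5 = 1 → qPochhammer t t * ((1 - z) * qPochhammer (z * t) t) *
      qPochhammer (z ^ 4 * t) t =
      (1 - z) * thetaTwo (t ^ 5) + t * (z ^ 2 - z ^ 4) * thetaOne (t ^ 5) := by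
    intro z hz
    have hz0 : z ≠ 0 := by rintro rfl; norm_num at hz
    rw [← tsum_thetaTerm_root_of_unity hz ht0 ht,
      (hasSum_jacobi_triple_product hz0 ht0 ht).tsum_eq, qPochhammer_eq_one_sub_mul z ht,
      show t / z = z ^ 4 * t by
        rw [div_eq_iff hz0]
        linear_combination -t * hz]
  have k1 := key w hw5
  have k2 := key (w ^ 2) (by rw [← pow_mul, mul_comm, pow_mul, hw5, one_pow])
  have h8 : (w ^ 2) ^ 4 = w ^ 3 := by linear_combination w ^ 3 * hw5
  rw [h8] at k2
  have hp := prod_qPochhammer_root_of_unity hw ht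
  apply mul_left_cancel₀ (mul_ne_zero hw1 hw2)
  have k12 := congrArg₂ (· * ·) k1 k2
  rw [← hp]
  trans ((1 - w) * thetaTwo (t ^ 5) + t * (w ^ 2 - w ^ 4) * thetaOne (t ^ 5)) *
    ((1 - w ^ 2) * thetaTwo (t ^ 5) + t * ((w ^ 2) ^ 2 - w ^ 3) * thetaOne (t ^ 5))
  · rw [← k12]
    ring
  · generalize thetaOne (t ^ 5) = A
    generalize thetaTwo (t ^ 5) = B
    grind

end Dissection

section Product

variable {t w : ℂ}

theorem norm_mul_lt_one_of_pow_eq_one {w : ℂ} (hw : w ^ 5 = 1) (ht : ‖t‖ < 1) (k : ℕ) :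
    ‖w ^ k * t‖ < 1 := by
  rw [norm_mul, norm_pow, Complex.norm_eq_one_of_pow_eq_one hw (by norm_num), one_pow, one_mul]
  exact ht

/-- The product of `(ωᵏt; ωᵏt)_∞` over the five fifth roots of unity `ωᵏ`. -/
theorem prod_qPochhammer_self_root_of_unity (hw : 1 + w + w ^ 2 + w ^ 3 + w ^ 4 = 0)
    (ht : ‖t‖ < 1) :
    qPochhammer t t * qPochhammer (w * t) (w * t) * qPochhammer (w ^ 2 * t) (w ^ 2 * t) *
      qPochhammer (w ^ 3 * t) (w ^ 3 * t) * qPochhammer (w ^ 4 * t) (w ^ 4 * t) *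
      qPochhammer ((t ^ 5) ^ 5) ((t ^ 5) ^ 5) = qPochhammer (t ^ 5) (t ^ 5) ^ 6 := by
  have hw5 : w ^ 5 = 1 := by linear_combination (w - 1) * hw
  have hr := norm_mul_lt_one_of_pow_eq_one hw5 ht
  have hr1 := hr 1
  rw [pow_one] at hr1
  have ht5 : ‖t ^ 5‖ < 1 := by simpa using pow_lt_one₀ (norm_nonneg t) ht (by norm_num)
  have ht25 : ‖(t ^ 5) ^ 5‖ < 1 := by simpa using pow_lt_one₀ (norm_nonneg _) ht5 (by norm_num)
  have h := ((((hasProd_qPochhammer t ht).mul (hasProd_qPochhammer (w * t) hr1)).mul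
    (hasProd_qPochhammer (w ^ 2 * t) (hr 2))).mul (hasProd_qPochhammer (w ^ 3 * t) (hr 3))).mul
    (hasProd_qPochhammer (w ^ 4 * t) (hr 4))
  have hfac : ∀ n : ℕ, (1 - t * t ^ n) * (1 - w * t * (w * t) ^ n) *
      (1 - w ^ 2 * t * (w ^ 2 * t) ^ n) * (1 - w ^ 3 * t * (w ^ 3 * t) ^ n) *
      (1 - w ^ 4 * t * (w ^ 4 * t) ^ n) =
      if n % 5 = 4 then (1 - t ^ (n + 1)) ^ 5 else 1 - (t ^ 5) ^ (n + 1) := by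
    intro n
    have hroot : ∀ v : ℂ, 1 + v + v ^ 2 + v ^ 3 + v ^ 4 = 0 → w ^ (n + 1) = v →
        (1 - t * t ^ n) * (1 - w * t * (w * t) ^ n) *
        (1 - w ^ 2 * t * (w ^ 2 * t) ^ n) * (1 - w ^ 3 * t * (w ^ 3 * t) ^ n) *
        (1 - w ^ 4 * t * (w ^ 4 * t) ^ n) = 1 - (t ^ 5) ^ (n + 1) := by
      rintro _ hv rfl
      have := prod_sub_root_of_unity_mul hv 1 (t ^ (n + 1))
      rw [← pow_mul, mul_comm 5, pow_mul]
      rw [one_pow] at this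
      rw [← this]
      ring
    have hmod : w ^ (n + 1) = w ^ ((n + 1) % 5) := pow_eq_pow_mod _ hw5
    split_ifs with h4
    · rw [show (n + 1) % 5 = 0 by omega, pow_zero] at hmod
      have e : ∀ k : ℕ, w ^ k * t * (w ^ k * t) ^ n = t ^ (n + 1) := fun k => by
        rw [← pow_succ', mul_pow, ← pow_mul, mul_comm k, pow_mul, hmod, one_pow, one_mul]
      have e0 := e 0
      have e1 := e 1
      rw [pow_zero, one_mul] at e0
      rw [pow_one] at e1
      rw [e0, e1, e 2, e 3, e 4]
      ring
    · have h5 : (n + 1) % 5 = 1 ∨ (n + 1) % 5 = 2 ∨ (n + 1) % 5 = 3 ∨ (n + 1) % 5 = 4 := by omega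
      rcases h5 with h5 | h5 | h5 | h5 <;> rw [h5] at hmod <;> refine hroot _ ?_ hmod
      · linear_combination hw
      · linear_combination hw + (w + w ^ 3) * hw5
      · linear_combination hw + (w + w ^ 4 + w ^ 2 + w ^ 7) * hw5
      · linear_combination hw + (w ^ 3 + w ^ 2 + w ^ 7 + w + w ^ 6 + w ^ 11) * hw5
  simp only [hfac] at h
  have h' := hasProd_of_mod_five (f := fun n : ℕ =>
      if n % 5 = 4 then (1 - t ^ (n + 1)) ^ 5 else 1 - (t ^ 5) ^ (n + 1))
      (a := ![qPochhammer (t ^ 5) ((t ^ 5) ^ 5), qPochhammer ((t ^ 5) ^ 2) ((t ^ 5) ^ 5),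
        qPochhammer ((t ^ 5) ^ 3) ((t ^ 5) ^ 5), qPochhammer ((t ^ 5) ^ 4) ((t ^ 5) ^ 5),
        qPochhammer (t ^ 5) (t ^ 5) ^ 5]) fun i => by
    have hmod : ∀ m : ℕ, (5 * m + (i : ℕ)) % 5 = i := fun m => by omega
    simp only [hmod]
    fin_cases i
    · convert! hasProd_qPochhammer (t ^ 5) ht25 using 2 with n
      simp
      ring
    · convert! hasProd_qPochhammer ((t ^ 5) ^ 2) ht25 using 2 with n
      simp
      ring
    · convert! hasProd_qPochhammer ((t ^ 5) ^ 3) ht25 using 2 with n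
      simp
      ring
    · convert! hasProd_qPochhammer ((t ^ 5) ^ 4) ht25 using 2 with n
      simp
      ring
    · convert! (hasProd_qPochhammer (t ^ 5) ht5).pow 5 using 2 with n
      simp
      ring
  have hE := qPochhammer_self_eq_prod ht5
  rw [Fin.prod_univ_five] at hE
  rw [h.unique h', Fin.prod_univ_five]
  simp at hE ⊢
  linear_combination (-(qPochhammer (t ^ 5) (t ^ 5)) ^ 5) * hE

theorem thetaTwo_pow_ten_sub (ht0 : t ≠ 0) (ht : ‖t‖ < 1) :
    (thetaTwo (t ^ 5) ^ 10 - 11 * t ^ 5 * thetaOne (t ^ 5) ^ 5 * thetaTwo (t ^ 5) ^ 5 -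
      (t ^ 5) ^ 2 * thetaOne (t ^ 5) ^ 10) * qPochhammer ((t ^ 5) ^ 5) ((t ^ 5) ^ 5) =
      qPochhammer (t ^ 5) (t ^ 5) ^ 11 := by
  obtain ⟨w, hw⟩ : ∃ w : ℂ, 1 + w + w ^ 2 + w ^ 3 + w ^ 4 = 0 := by
    have h := (Complex.isPrimitiveRoot_exp 5 (by norm_num)).geom_sum_eq_zero (by norm_num)
    exact ⟨_, by simpa [Finset.sum_range_succ] using h⟩
  have hw5 : w ^ 5 = 1 := by linear_combination (w - 1) * hw
  have hw0 : w ≠ 0 := by rintro rfl; norm_num at hw5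
  have key : ∀ k : ℕ, qPochhammer (w ^ k * t) (w ^ k * t) * qPochhammer (t ^ 5) (t ^ 5) =
      thetaTwo (t ^ 5) ^ 2 - w ^ k * t * thetaOne (t ^ 5) * thetaTwo (t ^ 5) -
        (w ^ k * t) ^ 2 * thetaOne (t ^ 5) ^ 2 := by
    intro k
    have h := qPochhammer_mul_qPochhammer_pow_five hw (mul_ne_zero (pow_ne_zero k hw0) ht0)
      (norm_mul_lt_one_of_pow_eq_one hw5 ht k)
    rwa [show (w ^ k * t) ^ 5 = t ^ 5 by
      rw [mul_pow, ← pow_mul, mul_comm k, pow_mul, hw5, one_pow, one_mul]] at h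
  have k0 := key 0
  have k1 := key 1
  rw [pow_zero, one_mul] at k0
  rw [pow_one] at k1
  have hN := prod_qPochhammer_self_root_of_unity hw ht
  have hfac : ∃ a b : ℂ, a + b = 1 ∧ a * b = -1 := by
    obtain ⟨s, hs⟩ := IsAlgClosed.exists_pow_nat_eq (5 : ℂ) two_pos
    exact ⟨(1 + s) / 2, (1 - s) / 2, by ring, by linear_combination -hs / 4⟩
  obtain ⟨a, b, hab, hab'⟩ := hfac
  generalize thetaOne (t ^ 5) = A at *
  generalize thetaTwo (t ^ 5) = B at *
  have hsplit : ∀ x : ℂ, B ^ 2 - x * A * B - x ^ 2 * A ^ 2 =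
      (B - x * (a * A)) * (B - x * (b * A)) := by
    intro x
    linear_combination x * A * B * hab - x ^ 2 * A ^ 2 * hab'
  simp only [hsplit] at k0 k1 key
  have ha := prod_sub_root_of_unity_mul hw B (t * (a * A))
  have hb := prod_sub_root_of_unity_mul hw B (t * (b * A))
  simp only [← mul_assoc _ t] at ha hb
  have h5 : a ^ 5 + b ^ 5 = 11 := by
    obtain rfl : b = 1 - a := by linear_combination hab
    linear_combination (5 * (a * (1 - a)) - 10) * hab'
  have h10 : (a * b) ^ 5 = -1 := by rw [hab']; norm_num
  have hprod : (B ^ 5 - (t * (a * A)) ^ 5) * (B ^ 5 - (t * (b * A)) ^ 5) =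
      (qPochhammer t t * qPochhammer (w * t) (w * t) * qPochhammer (w ^ 2 * t) (w ^ 2 * t) *
      qPochhammer (w ^ 3 * t) (w ^ 3 * t) * qPochhammer (w ^ 4 * t) (w ^ 4 * t)) *
      qPochhammer (t ^ 5) (t ^ 5) ^ 5 := by
    trans (qPochhammer t t * qPochhammer (t ^ 5) (t ^ 5)) *
      (qPochhammer (w * t) (w * t) * qPochhammer (t ^ 5) (t ^ 5)) *
      (qPochhammer (w ^ 2 * t) (w ^ 2 * t) * qPochhammer (t ^ 5) (t ^ 5)) *
      (qPochhammer (w ^ 3 * t) (w ^ 3 * t) * qPochhammer (t ^ 5) (t ^ 5)) *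
      (qPochhammer (w ^ 4 * t) (w ^ 4 * t) * qPochhammer (t ^ 5) (t ^ 5))
    · rw [k0, k1, key 2, key 3, key 4, ← ha, ← hb]
      ring
    · ring
  linear_combination qPochhammer ((t ^ 5) ^ 5) ((t ^ 5) ^ 5) * hprod +
    qPochhammer (t ^ 5) (t ^ 5) ^ 5 * hN + qPochhammer ((t ^ 5) ^ 5) ((t ^ 5) ^ 5) *
    (t ^ 5 * A ^ 5 * B ^ 5 * h5 - t ^ 10 * A ^ 10 * h10)

end Product

section RogersRamanujan

variable {q : ℝ}

theorem norm_ofReal_lt_one (hq0 : 0 < q) (hq1 : q < 1) : ‖(q : ℂ)‖ < 1 := by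
  rwa [Complex.norm_real, Real.norm_of_nonneg hq0.le]

theorem ofReal_tprod_of_hasProd {f : ℕ → ℝ} {a : ℂ} (h : HasProd (fun n => (f n : ℂ)) a) :
    ((∏' n, f n : ℝ) : ℂ) = a := by
  have hre : a = (a.re : ℂ) := by
    have hclosed : IsClosed (Set.range ((↑) : ℝ → ℂ)) :=
      Complex.isometry_ofReal.isClosedEmbedding.isClosed_range
    obtain ⟨r, rfl⟩ := hclosed.mem_of_tendsto h
      (.of_forall fun s => ⟨∏ n ∈ s, f n, by push_cast; rfl⟩)
    simp
  have h2 : HasProd f a.re := by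
    have := (Complex.continuous_re.tendsto a).comp h
    refine this.congr fun s => ?_
    simp [← Complex.ofReal_prod]
  rw [h2.tprod_eq, ← hre]

theorem ofReal_ramanujanF (hq0 : 0 < q) (hq1 : q < 1) :
    (ramanujanF q : ℂ) = qPochhammer q q := by
  refine ofReal_tprod_of_hasProd ?_
  convert hasProd_qPochhammer (q : ℂ) (norm_ofReal_lt_one hq0 hq1) using 2 with n
  push_cast
  ring

theorem ofReal_rogersRamanujan_pow_five (hq0 : 0 < q) (hq1 : q < 1) :
    (rogersRamanujan q : ℂ) ^ 5 = q * (thetaOne q / thetaTwo q) ^ 5 := by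
  have : Fact (Nat.Prime 5) := ⟨by norm_num⟩
  have hq := norm_ofReal_lt_one hq0 hq1
  have hq5 : ‖(q : ℂ) ^ 5‖ < 1 := by simpa using pow_lt_one₀ (norm_nonneg _) hq (by norm_num)
  have hlt : ∀ k : ℕ, k ≠ 0 → ‖(q : ℂ) ^ k‖ < 1 := fun k hk => by
    simpa using pow_lt_one₀ (norm_nonneg _) hq hk
  have hne : ∀ k : ℕ, k ≠ 0 → qPochhammer ((q : ℂ) ^ k) ((q : ℂ) ^ 5) ≠ 0 := fun k hk =>
    qPochhammer_ne_zero (mul_pow_ne_one (hlt k hk) hq5) hq5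
  have hprod : ((∏' n : ℕ, (1 - q ^ (n + 1)) ^ legendreSym 5 (n + 1) : ℝ) : ℂ) =
      thetaOne q / thetaTwo q := by
    have h := hasProd_of_mod_five
      (f := fun n : ℕ => (((1 - q ^ (n + 1)) ^ legendreSym 5 (n + 1) : ℝ) : ℂ))
      (a := ![qPochhammer ((q : ℂ) ^ 1) ((q : ℂ) ^ 5), (qPochhammer ((q : ℂ) ^ 2) ((q : ℂ) ^ 5))⁻¹,
        (qPochhammer ((q : ℂ) ^ 3) ((q : ℂ) ^ 5))⁻¹, qPochhammer ((q : ℂ) ^ 4) ((q : ℂ) ^ 5), 1])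
      fun i => by
        have hleg : ∀ m : ℕ, legendreSym 5 (((5 * m + (i : ℕ) : ℕ) : ℤ) + 1) =
            legendreSym 5 ((i : ℕ) + 1) := fun m => by
          rw [legendreSym.mod, legendreSym.mod 5 ((i : ℕ) + 1)]
          congr 1
          push_cast
          omega
        have l1 : legendreSym 5 1 = 1 := by norm_num
        have l2 : legendreSym 5 2 = -1 := by norm_num
        have l3 : legendreSym 5 3 = -1 := by norm_num
        have l4 : legendreSym 5 4 = 1 := by norm_num
        have l5 : legendreSym 5 5 = 0 := by norm_num
        simp only [hleg]
        fin_cases i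
        · convert! hasProd_qPochhammer ((q : ℂ) ^ 1) hq5 using 2 with n
          simp [l1]
          ring
        · convert! (hasProd_qPochhammer ((q : ℂ) ^ 2) hq5).inv₀ (hne 2 two_ne_zero) using 2 with n
          norm_num [l2]
          ring
        · convert! (hasProd_qPochhammer ((q : ℂ) ^ 3) hq5).inv₀ (hne 3 three_ne_zero) using 2 with n
          norm_num [l3]
          ring
        · convert! hasProd_qPochhammer ((q : ℂ) ^ 4) hq5 using 2 with n
          norm_num [l4]
          ring
        · convert! (hasProd_one : HasProd (fun _ : ℕ => (1 : ℂ)) 1) using 2 with n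
    rw [ofReal_tprod_of_hasProd h, Fin.prod_univ_five, thetaOne, thetaTwo]
    have h2 := hne 2 two_ne_zero
    have h3 := hne 3 three_ne_zero
    have h5 := hne 5 (by norm_num)
    simp
    field_simp
  have hroot : (q ^ ((1 : ℝ) / 5)) ^ 5 = q := by
    rw [← Real.rpow_natCast, ← Real.rpow_mul hq0.le]
    norm_num
  rw [rogersRamanujan, Complex.ofReal_mul, mul_pow, hprod, ← Complex.ofReal_pow, hroot]

end RogersRamanujan

/-- `R(q)⁻⁵ - 11 - R(q)⁵ = f(-q)⁶ / (q f(-q⁵)⁶)` for `0 < q < 1`. -/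
theorem rogersRamanujan_pow_five_identity (q : ℝ) (hq0 : 0 < q) (hq1 : q < 1) :
    ((rogersRamanujan q) ^ 5)⁻¹ - 11 - (rogersRamanujan q) ^ 5 =
      (ramanujanF q) ^ 6 / (q * (ramanujanF (q ^ 5)) ^ 6) := by
  have hq := norm_ofReal_lt_one hq0 hq1
  have hq5 : ‖(q : ℂ) ^ 5‖ < 1 := by simpa using pow_lt_one₀ (norm_nonneg _) hq (by norm_num)
  obtain ⟨t, ht⟩ := IsAlgClosed.exists_pow_nat_eq (q : ℂ) (n := 5) (by norm_num)
  have hqc : (q : ℂ) ≠ 0 := by exact_mod_cast hq0.ne'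
  have ht0 : t ≠ 0 := by
    rintro rfl
    exact hqc (by simp [← ht])
  have ht1 : ‖t‖ < 1 := by
    rw [← ht, norm_pow] at hq
    exact lt_of_pow_lt_pow_left₀ 5 zero_le_one (by simpa using hq)
  have key := thetaTwo_pow_ten_sub ht0 ht1
  rw [ht] at key
  have hprod := thetaOne_mul_thetaTwo hq
  have hE := qPochhammer_self_ne_zero hq
  have hE5 := qPochhammer_self_ne_zero hq5
  have h12 : thetaOne q * thetaTwo q ≠ 0 := hprod ▸ mul_ne_zero hE hE5
  have h1 := left_ne_zero_of_mul h12
  have h2 := right_ne_zero_of_mul h12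
  rw [← Complex.ofReal_inj]
  push_cast
  rw [ofReal_rogersRamanujan_pow_five hq0 hq1, ofReal_ramanujanF hq0 hq1,
    ofReal_ramanujanF (by positivity) (pow_lt_one₀ hq0.le hq1 (by norm_num))]
  push_cast
  generalize qPochhammer (q : ℂ) q = E at *
  generalize qPochhammer ((q : ℂ) ^ 5) ((q : ℂ) ^ 5) = F at *
  generalize thetaOne (q : ℂ) = A at *
  generalize thetaTwo (q : ℂ) = B at *
  have hpow : A ^ 5 * B ^ 5 = E ^ 5 * F ^ 5 := by rw [← mul_pow, hprod, mul_pow]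
  trans (B ^ 10 - 11 * q * A ^ 5 * B ^ 5 - (q : ℂ) ^ 2 * A ^ 10) / (q * (A ^ 5 * B ^ 5))
  · field_simp
  · rw [hpow, div_eq_div_iff (by positivity) (by positivity)]
    linear_combination (q * F ^ 5) * key
end

section
/- For 0 < q < 1, the logarithmic derivative of the Rogers-Ramanujan continued fraction satisfies R'(q)/R(q) = f(−q)⁵ / (5 q f(−q⁵)), where f(−q) = ∏_{n≥1}(1−qⁿ). -/
open Filter Topology

/-- The infinite `q`-Pochhammer symbol `(x; q)_∞`. -/
noncomputable def qPoch (q x : ℂ) : ℂ := ∏' n : ℕ, (1 - x * q ^ n)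

/-- The modified theta function `θ(x; q) = (x; q)_∞ (q / x; q)_∞`. -/
noncomputable def modTheta (q x : ℂ) : ℂ := qPoch q x * qPoch q (q / x)

/-- The series `∑ₙ x qⁿ / (1 - x qⁿ)²` over natural `n`, one half of the `q`-analogue of `℘`. -/
noncomputable def halfWp (q x : ℂ) : ℂ := ∑' n : ℕ, x * q ^ n / (1 - x * q ^ n) ^ 2

/-- The multiplicative Weierstrass function `∑ₙ x qⁿ / (1 - x qⁿ)²` over all integers `n`. -/
noncomputable def mulWp (q x : ℂ) : ℂ := halfWp q x + halfWp q (q / x)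

section

variable {q : ℂ}

lemma summable_norm_mul_pow (hq : ‖q‖ < 1) (x : ℂ) : Summable fun n : ℕ => ‖-(x * q ^ n)‖ := by
  simpa using (summable_geometric_of_lt_one (norm_nonneg q) hq).mul_left ‖x‖

lemma multipliable_qPoch (hq : ‖q‖ < 1) (x : ℂ) : Multipliable fun n : ℕ => 1 - x * q ^ n := by
  simpa [sub_eq_add_neg] using multipliable_one_add_of_summable (summable_norm_mul_pow hq x)

lemma qPoch_eq_mul (hq : ‖q‖ < 1) (x : ℂ) : qPoch q x = (1 - x) * qPoch q (q * x) := by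
  have h (n : ℕ) : 1 - x * q ^ (n + 1) = 1 - q * x * q ^ n := by ring
  rw [qPoch, tprod_eq_zero_mul' (by simpa only [h] using multipliable_qPoch hq (q * x))]
  simp [qPoch, h]

lemma qPoch_ne_zero (hq : ‖q‖ < 1) {x : ℂ} (hx : ∀ n : ℕ, x * q ^ n ≠ 1) : qPoch q x ≠ 0 := by
  have := tprod_one_add_ne_zero_of_summable (f := fun n : ℕ => -(x * q ^ n))
    (fun n h => hx n (by linear_combination -h)) (summable_norm_mul_pow hq x)
  simpa [qPoch, sub_eq_add_neg] using this

lemma norm_mul_pow_lt_one (hq : ‖q‖ < 1) {x : ℂ} (hx : ‖x‖ < 1) (n : ℕ) : ‖x * q ^ n‖ < 1 := by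
  rw [norm_mul, norm_pow]
  exact (mul_le_of_le_one_right (norm_nonneg _) (pow_le_one₀ (norm_nonneg _) hq.le)).trans_lt hx

lemma qPoch_ne_zero_of_norm_lt_one (hq : ‖q‖ < 1) {x : ℂ} (hx : ‖x‖ < 1) : qPoch q x ≠ 0 :=
  qPoch_ne_zero hq fun n h => by simpa [h] using norm_mul_pow_lt_one hq hx n

lemma differentiable_qPoch (hq : ‖q‖ < 1) : Differentiable ℂ (qPoch q) := by
  intro x
  have hs : Summable fun n : ℕ => (‖x‖ + 1) * ‖q‖ ^ n :=
    (summable_geometric_of_lt_one (norm_nonneg q) hq).mul_left _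
  have hP := hs.hasProdLocallyUniformlyOn_nat_one_add (K := Metric.ball (0 : ℂ) (‖x‖ + 1))
    (f := fun n y => -(y * q ^ n)) Metric.isOpen_ball
    (.of_forall fun n y hy => by
      rw [norm_neg, norm_mul, norm_pow]
      gcongr
      simpa using (Metric.mem_ball.1 hy).le)
    (fun n => by fun_prop)
  have hd := hP.differentiableOn (.of_forall fun _ ↦ by
    simpa [Finset.prod_fn] using DifferentiableOn.finsetProd (fun _ _ ↦ by fun_prop))
    Metric.isOpen_ball
  have := hd.differentiableAt (Metric.isOpen_ball.mem_nhds (by simp : x ∈ _))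
  have he : qPoch q = fun x => ∏' n : ℕ, (1 + -(x * q ^ n)) := by
    ext x
    simp only [qPoch, sub_eq_add_neg]
  rwa [he]

lemma norm_div_one_sub_sq_le {r : ℝ} (hr : r < 1) {u : ℂ} (hu : ‖u‖ ≤ r) :
    ‖u / (1 - u) ^ 2‖ ≤ ‖u‖ / (1 - r) ^ 2 := by
  have h : 1 - r ≤ ‖1 - u‖ := by
    have := norm_sub_norm_le (1 : ℂ) u
    rw [norm_one] at this
    linarith
  rw [norm_div, norm_pow]
  have : 0 < 1 - r := by linarith
  gcongr

lemma summable_halfWp_of_norm_lt_one (hq : ‖q‖ < 1) {x : ℂ} (hx : ‖x‖ < 1) :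
    Summable fun n : ℕ => x * q ^ n / (1 - x * q ^ n) ^ 2 := by
  refine .of_norm_bounded
    (((summable_geometric_of_lt_one (norm_nonneg q) hq).mul_left ‖x‖).div_const ((1 - ‖x‖) ^ 2))
    fun n => ?_
  simpa using norm_div_one_sub_sq_le hx (u := x * q ^ n) (by
    rw [norm_mul, norm_pow]
    exact mul_le_of_le_one_right (norm_nonneg _) (pow_le_one₀ (norm_nonneg _) hq.le))

lemma summable_halfWp (hq : ‖q‖ < 1) (x : ℂ) :
    Summable fun n : ℕ => x * q ^ n / (1 - x * q ^ n) ^ 2 := by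
  have ht : Tendsto (fun n : ℕ => x * q ^ n) atTop (𝓝 (x * 0)) :=
    (tendsto_pow_atTop_nhds_zero_of_norm_lt_one hq).const_mul x
  rw [mul_zero] at ht
  obtain ⟨N, hN⟩ := (ht.norm.eventually_lt_const (u := 1) (by simp)).exists
  refine (summable_nat_add_iff N).1 ?_
  refine (summable_halfWp_of_norm_lt_one hq hN).congr fun n => ?_
  rw [pow_add, mul_assoc, mul_comm (q ^ N)]

lemma halfWp_eq_add (hq : ‖q‖ < 1) (x : ℂ) :
    halfWp q x = x / (1 - x) ^ 2 + halfWp q (q * x) := by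
  rw [halfWp, (summable_halfWp hq x).tsum_eq_zero_add, halfWp]
  rw [pow_zero, mul_one]
  congr 1
  exact tsum_congr fun n => by rw [show x * q ^ (n + 1) = q * x * q ^ n by ring]

lemma differentiableAt_halfWp (hq : ‖q‖ < 1) {x : ℂ} (hx : ‖x‖ < 1) :
    DifferentiableAt ℂ (halfWp q) x := by
  obtain ⟨r, hxr, hr⟩ := exists_between hx
  have hr0 : 0 < r := (norm_nonneg x).trans_lt hxr
  have hb (n : ℕ) (w : ℂ) (hw : w ∈ Metric.ball (0 : ℂ) r) : ‖w * q ^ n‖ ≤ r * ‖q‖ ^ n := by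
    rw [norm_mul, norm_pow]
    gcongr
    simpa using (Metric.mem_ball.1 hw).le
  have hb' (n : ℕ) : r * ‖q‖ ^ n ≤ r :=
    mul_le_of_le_one_right hr0.le (pow_le_one₀ (norm_nonneg _) hq.le)
  have := Complex.differentiableOn_tsum_of_summable_norm
    (F := fun (n : ℕ) w => w * q ^ n / (1 - w * q ^ n) ^ 2) (U := Metric.ball 0 r)
    (((summable_geometric_of_lt_one (norm_nonneg q) hq).mul_left r).div_const ((1 - r) ^ 2))
    (fun n => by
      refine DifferentiableOn.div (by fun_prop) (by fun_prop) fun w hw => pow_ne_zero 2 fun h => ?_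
      have h1 := (hb n w hw).trans (hb' n)
      rw [← sub_eq_zero.1 h, norm_one] at h1
      linarith)
    Metric.isOpen_ball
    (fun n w hw => (norm_div_one_sub_sq_le hr ((hb n w hw).trans (hb' n))).trans (by
      gcongr
      exact hb n w hw))
  exact this.differentiableAt (Metric.isOpen_ball.mem_nhds (by simpa using hxr))

lemma modTheta_mul_left (hq : ‖q‖ < 1) (hq0 : q ≠ 0) {x : ℂ} (hx : x ≠ 0) :
    modTheta q (q * x) = -modTheta q x / x := by
  have h : q / (q * x) = x⁻¹ := by field_simp
  rw [modTheta, modTheta, h, qPoch_eq_mul hq x, qPoch_eq_mul hq x⁻¹, ← div_eq_mul_inv]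
  field_simp
  ring

lemma modTheta_inv (hq : ‖q‖ < 1) {x : ℂ} (hx : x ≠ 0) :
    modTheta q x⁻¹ = -modTheta q x / x := by
  rw [modTheta, modTheta, qPoch_eq_mul hq x, qPoch_eq_mul hq x⁻¹, ← div_eq_mul_inv, div_inv_eq_mul]
  field_simp
  ring

lemma inv_div_one_sub_inv_sq (x : ℂ) : x⁻¹ / (1 - x⁻¹) ^ 2 = x / (1 - x) ^ 2 := by
  rcases eq_or_ne x 0 with rfl | hx
  · simp
  rcases eq_or_ne x 1 with rfl | hx1
  · simp
  have h1 : 1 - x ≠ 0 := sub_ne_zero.2 hx1.symm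
  have h2 : x - 1 ≠ 0 := sub_ne_zero.2 hx1
  field_simp
  ring

lemma mulWp_eq (hq : ‖q‖ < 1) (x : ℂ) :
    mulWp q x = x / (1 - x) ^ 2 + (halfWp q (q * x) + halfWp q (q / x)) := by
  rw [mulWp, halfWp_eq_add hq x, add_assoc]

lemma mulWp_mul_left (hq : ‖q‖ < 1) (hq0 : q ≠ 0) (x : ℂ) : mulWp q (q * x) = mulWp q x := by
  have h : q / (q * x) = x⁻¹ := by field_simp
  rw [mulWp_eq hq x, mulWp, h, halfWp_eq_add hq x⁻¹, ← div_eq_mul_inv q, inv_div_one_sub_inv_sq]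
  ring

lemma mulWp_inv (hq : ‖q‖ < 1) (x : ℂ) : mulWp q x⁻¹ = mulWp q x := by
  rw [mulWp_eq hq x, mulWp_eq hq, inv_div_one_sub_inv_sq, div_inv_eq_mul, ← div_eq_mul_inv,
    add_comm (halfWp q (q * x))]

lemma isPreconnected_annulus {a b : ℝ} (ha : 0 < a) (hb : 0 < b) :
    IsPreconnected {x : ℂ | a < ‖x‖ ∧ ‖x‖ < b} := by
  have : {x : ℂ | a < ‖x‖ ∧ ‖x‖ < b} =
      Complex.exp '' (Complex.re ⁻¹' Set.Ioo (Real.log a) (Real.log b)) := by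
    ext x
    constructor
    · rintro ⟨h1, h2⟩
      have hx : x ≠ 0 := norm_pos_iff.1 (ha.trans h1)
      refine ⟨Complex.log x, ?_, Complex.exp_log hx⟩
      simp only [Set.mem_preimage, Complex.log_re, Set.mem_Ioo]
      exact ⟨Real.log_lt_log ha h1, Real.log_lt_log (ha.trans h1) h2⟩
    · rintro ⟨z, ⟨h1, h2⟩, rfl⟩
      rw [Set.mem_ofPred_eq, Complex.norm_exp]
      exact ⟨(Real.log_lt_iff_lt_exp ha).1 h1, (Real.lt_log_iff_exp_lt hb).1 h2⟩
  rw [this]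
  refine IsPreconnected.image ?_ _ Complex.continuous_exp.continuousOn
  exact ((convex_Ioo _ _).linear_preimage Complex.reLm).isPreconnected

/-- A function on `ℂˣ` invariant under `x ↦ q x` and `x ↦ x⁻¹` whose only possible pole in the
annulus `‖q‖ < ‖x‖ < ‖q‖⁻¹` is a simple one at `1` is constant. -/
lemma eq_of_qPeriodic (hq : ‖q‖ < 1) (hq0 : q ≠ 0) {g K : ℂ → ℂ}
    (hg : DifferentiableOn ℂ g {x | ‖q‖ < ‖x‖ ∧ ‖x‖ < ‖q‖⁻¹}) (hg1 : g 1 = 0)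
    (hK : ∀ x, ‖q‖ < ‖x‖ → ‖x‖ < ‖q‖⁻¹ → x ≠ 1 → K x = g x / (1 - x) ^ 2)
    (hKq : ∀ x, x ≠ 0 → K (q * x) = K x) (hKi : ∀ x, x ≠ 0 → K x⁻¹ = K x)
    {x y : ℂ} (hx : ‖q‖ < ‖x‖) (hx' : ‖x‖ < ‖q‖⁻¹) (hx1 : x ≠ 1)
    (hy : ‖q‖ < ‖y‖) (hy' : ‖y‖ < ‖q‖⁻¹) (hy1 : y ≠ 1) : K x = K y := by
  have hr0 : 0 < ‖q‖ := norm_pos_iff.2 hq0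
  have hr1 : 1 < ‖q‖⁻¹ := (one_lt_inv₀ hr0).2 hq
  set A : Set ℂ := {x | ‖q‖ < ‖x‖ ∧ ‖x‖ < ‖q‖⁻¹} with hA
  have hAo : IsOpen A :=
    (isOpen_lt continuous_const continuous_norm).inter (isOpen_lt continuous_norm continuous_const)
  have h1A : (1 : ℂ) ∈ A := by simp [hA, hq, hr1]
  have hAn : A ∈ 𝓝 (1 : ℂ) := hAo.mem_nhds h1A
  have hgd : DifferentiableAt ℂ g 1 := hg.differentiableAt hAn
  have hsymm : ∀ᶠ x in 𝓝 (1 : ℂ), g x⁻¹ = g x / x ^ 2 := by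
    filter_upwards [hAn] with x hx
    have hx0 : x ≠ 0 := norm_pos_iff.1 (hr0.trans hx.1)
    rcases eq_or_ne x 1 with rfl | h1
    · simp
    have hi := hK x⁻¹ (by rw [norm_inv]; exact (lt_inv_comm₀ hr0 (hr0.trans hx.1)).2 hx.2)
      (by rw [norm_inv]; exact (inv_lt_inv₀ (hr0.trans hx.1) hr0).2 hx.1) (by simpa using h1)
    rw [hKi x hx0, hK x hx.1 hx.2 h1] at hi
    have h2 : x - 1 ≠ 0 := sub_ne_zero.2 h1
    have h3 : 1 - x ≠ 0 := sub_ne_zero.2 h1.symm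
    have h4 : 1 - x⁻¹ ≠ 0 := sub_ne_zero.2 (by simpa [eq_comm] using h1)
    rw [div_eq_div_iff (pow_ne_zero 2 h3) (pow_ne_zero 2 h4)] at hi
    rw [eq_div_iff (pow_ne_zero 2 hx0)]
    refine mul_right_cancel₀ (pow_ne_zero 2 h3) ?_
    have h5 : (1 - x⁻¹) ^ 2 * x ^ 2 = (1 - x) ^ 2 := by field_simp; ring
    linear_combination -x ^ 2 * hi + g x * h5
  have hderiv : deriv g 1 = 0 := by
    have e1 : HasDerivAt (fun x : ℂ => g x⁻¹) (deriv g 1 * (-((1 : ℂ) ^ 2)⁻¹)) 1 := by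
      have h0 : HasDerivAt g (deriv g 1) ((1 : ℂ)⁻¹) := by simpa using hgd.hasDerivAt
      exact h0.comp 1 (hasDerivAt_inv one_ne_zero)
    have e2 := hgd.hasDerivAt.fun_div (hasDerivAt_pow 2 (1 : ℂ)) (by simp)
    have := (e1.congr_of_eventuallyEq (hsymm.mono fun x hx => hx.symm)).unique e2
    rw [hg1] at this
    norm_num at this
    linear_combination -this / 2
  let L : ℂ → ℂ := dslope (dslope g 1) 1
  have hL : DifferentiableOn ℂ L A :=
    (Complex.differentiableOn_dslope hAn).2 ((Complex.differentiableOn_dslope hAn).2 hg)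
  have hLK : ∀ x ∈ A, x ≠ 1 → L x = K x := by
    intro x hx h1
    have h2 : x - 1 ≠ 0 := sub_ne_zero.2 h1
    have h3 : 1 - x ≠ 0 := sub_ne_zero.2 h1.symm
    rw [hK x hx.1 hx.2 h1]
    simp only [L, dslope_of_ne _ h1, slope_def_field, dslope_same, hderiv, hg1]
    field_simp
    ring
  -- the maximum of `‖L‖` over a closed fundamental annulus is a maximum over `A`
  obtain ⟨s, hs1, hs⟩ : ∃ s : ℝ, 1 < s ∧ s ^ 2 = ‖q‖⁻¹ := by
    refine ⟨√‖q‖⁻¹, Real.lt_sqrt_of_sq_lt (by simpa using hr1), Real.sq_sqrt (by positivity)⟩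
  have hs0 : 0 < s := one_pos.trans hs1
  have hqs : ‖q‖ = (s ^ 2)⁻¹ := by rw [hs, inv_inv]
  set B : Set ℂ := {x | s⁻¹ ≤ ‖x‖ ∧ ‖x‖ ≤ s} with hB
  have hBc : IsCompact B := by
    refine Metric.isCompact_of_isClosed_isBounded ?_ ?_
    · exact (isClosed_le continuous_const continuous_norm).inter
        (isClosed_le continuous_norm continuous_const)
    · exact (Metric.isBounded_closedBall (x := (0 : ℂ)) (r := s)).subset
        fun x hx => by simpa using hx.2
  have hBA : B ⊆ A := by
    rintro x ⟨h1, h2⟩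
    refine ⟨lt_of_lt_of_le ?_ h1, lt_of_le_of_lt h2 ?_⟩
    · rw [hqs, inv_lt_inv₀ (by positivity) hs0]
      nlinarith
    · rw [← hs]
      nlinarith
  have h1B : (1 : ℂ) ∈ B := by simp [hB, inv_le_one_of_one_le₀ hs1.le, hs1.le]
  obtain ⟨c, hcB, hc⟩ := hBc.exists_isMaxOn ⟨1, h1B⟩ (hL.continuousOn.mono hBA).norm
  have hmax : IsMaxOn (norm ∘ L) A c := by
    have key : ∀ x ∈ A, ∃ x' ∈ B, L x = L x' := by
      intro x hx
      have hx0 : x ≠ 0 := norm_pos_iff.1 (hr0.trans hx.1)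
      by_cases h1 : ‖x‖ < s⁻¹
      · have hlt : s⁻¹ < 1 := inv_lt_one_of_one_lt₀ hs1
        have hn : ‖q⁻¹ * x‖ = s ^ 2 * ‖x‖ := by rw [norm_mul, norm_inv, hqs, inv_inv]
        have hgt : 1 < ‖q⁻¹ * x‖ := by
          have := hx.1
          rw [hqs, inv_lt_iff_one_lt_mul₀ (by positivity)] at this
          rwa [hn, mul_comm]
        have hle : ‖q⁻¹ * x‖ ≤ s := by
          rw [hn]
          calc s ^ 2 * ‖x‖ ≤ s ^ 2 * s⁻¹ := by gcongr
            _ = s := by field_simp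
        have hmem : q⁻¹ * x ∈ B := ⟨(hlt.trans hgt).le, hle⟩
        refine ⟨q⁻¹ * x, hmem, ?_⟩
        rw [hLK x hx (by rintro rfl; simp at h1; linarith),
          hLK _ (hBA hmem) (by intro h; simp [h] at hgt), ← hKq (q⁻¹ * x) (by positivity),
          mul_inv_cancel_left₀ hq0]
      by_cases h2 : s < ‖x‖
      · have hn : ‖q * x‖ = (s ^ 2)⁻¹ * ‖x‖ := by rw [norm_mul, hqs]
        have hlt : ‖q * x‖ < 1 := by
          have := hx.2
          rw [← hs] at this
          rw [hn, inv_mul_lt_iff₀ (by positivity)]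
          linarith
        have hge : s⁻¹ ≤ ‖q * x‖ := by
          rw [hn]
          calc s⁻¹ = (s ^ 2)⁻¹ * s := by field_simp
            _ ≤ _ := by gcongr
        have hmem : q * x ∈ B := ⟨hge, (hlt.trans hs1).le⟩
        refine ⟨q * x, hmem, ?_⟩
        rw [hLK x hx (by rintro rfl; simp at h2; linarith),
          hLK _ (hBA hmem) (by intro h; simp [h] at hlt), hKq x hx0]
      · exact ⟨x, ⟨not_lt.1 h1, not_lt.1 h2⟩, rfl⟩
    intro x hx
    obtain ⟨x', hx', he⟩ := key x hx
    simpa [he] using hc hx'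
  have hconst := Complex.eqOn_of_isPreconnected_of_isMaxOn_norm
    (isPreconnected_annulus hr0 (inv_pos.2 hr0)) hAo hL (hBA hcB) hmax
  rw [← hLK x ⟨hx, hx'⟩ hx1, ← hLK y ⟨hy, hy'⟩ hy1, hconst ⟨hx, hx'⟩, hconst ⟨hy, hy'⟩,
    Function.const_apply, Function.const_apply]

end

section

variable {q : ℂ}

lemma modTheta_eq (hq : ‖q‖ < 1) (x : ℂ) :
    modTheta q x = (1 - x) * (qPoch q (q * x) * qPoch q (q / x)) := by
  rw [modTheta, qPoch_eq_mul hq x, mul_assoc]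

lemma modTheta_one (hq : ‖q‖ < 1) : modTheta q 1 = 0 := by simp [modTheta_eq hq]

lemma differentiableAt_modTheta (hq : ‖q‖ < 1) {x : ℂ} (hx : x ≠ 0) :
    DifferentiableAt ℂ (modTheta q) x := by
  have hE := differentiable_qPoch hq
  unfold modTheta
  fun_prop (disch := assumption)

lemma norm_mul_lt_one_of_lt_inv (hq0 : q ≠ 0) {x : ℂ} (hx : ‖x‖ < ‖q‖⁻¹) : ‖q * x‖ < 1 := by
  have hr0 : 0 < ‖q‖ := norm_pos_iff.2 hq0
  rw [norm_mul]
  calc ‖q‖ * ‖x‖ < ‖q‖ * ‖q‖⁻¹ := by gcongr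
    _ = 1 := mul_inv_cancel₀ hr0.ne'

lemma norm_div_lt_one_of_lt {x : ℂ} (hx : ‖q‖ < ‖x‖) : ‖q / x‖ < 1 := by
  rw [norm_div]
  exact (div_lt_one ((norm_nonneg q).trans_lt hx)).2 hx

lemma qPoch_mul_qPoch_ne_zero (hq : ‖q‖ < 1) (hq0 : q ≠ 0) {x : ℂ} (hx : ‖q‖ < ‖x‖)
    (hx' : ‖x‖ < ‖q‖⁻¹) : qPoch q (q * x) * qPoch q (q / x) ≠ 0 :=
  mul_ne_zero (qPoch_ne_zero_of_norm_lt_one hq (norm_mul_lt_one_of_lt_inv hq0 hx'))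
    (qPoch_ne_zero_of_norm_lt_one hq (norm_div_lt_one_of_lt hx))

lemma modTheta_ne_zero (hq : ‖q‖ < 1) (hq0 : q ≠ 0) {x : ℂ} (hx : ‖q‖ < ‖x‖)
    (hx' : ‖x‖ < ‖q‖⁻¹) (hx1 : x ≠ 1) : modTheta q x ≠ 0 := by
  rw [modTheta_eq hq]
  exact mul_ne_zero (sub_ne_zero.2 hx1.symm) (qPoch_mul_qPoch_ne_zero hq hq0 hx hx')

/-- The factorisation of `℘(u) - ℘(v)`, in multiplicative form. -/
theorem mulWp_sub_mulWp (hq : ‖q‖ < 1) (hq0 : q ≠ 0) {x y : ℂ}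
    (hx : ‖q‖ < ‖x‖) (hx' : ‖x‖ < ‖q‖⁻¹) (hx1 : x ≠ 1)
    (hy : ‖q‖ < ‖y‖) (hy' : ‖y‖ < ‖q‖⁻¹) (hy1 : y ≠ 1) :
    mulWp q x - mulWp q y = qPoch q q ^ 4 / (modTheta q y * modTheta q y⁻¹) *
      (modTheta q (x * y) * modTheta q (x / y) / modTheta q x ^ 2) := by
  have hr0 : 0 < ‖q‖ := norm_pos_iff.2 hq0
  have hy0 : y ≠ 0 := norm_pos_iff.1 (hr0.trans hy)
  have hθy := modTheta_ne_zero hq hq0 hy hy' hy1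
  have hφ : qPoch q q ≠ 0 := qPoch_ne_zero_of_norm_lt_one hq hq
  set c : ℂ := qPoch q q ^ 4 / (modTheta q y * modTheta q y⁻¹) with hc
  let K : ℂ → ℂ := fun z =>
    mulWp q z - c * (modTheta q (z * y) * modTheta q (z / y) / modTheta q z ^ 2)
  let g : ℂ → ℂ := fun z => z + (1 - z) ^ 2 * (halfWp q (q * z) + halfWp q (q / z)) -
    c * (modTheta q (z * y) * modTheta q (z / y) / (qPoch q (q * z) * qPoch q (q / z)) ^ 2)
  have hg : DifferentiableOn ℂ g {x | ‖q‖ < ‖x‖ ∧ ‖x‖ < ‖q‖⁻¹} := by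
    rintro z ⟨hz, hz'⟩
    refine DifferentiableAt.differentiableWithinAt ?_
    have hz0 : z ≠ 0 := norm_pos_iff.1 (hr0.trans hz)
    have hE := differentiable_qPoch hq
    have h1 : DifferentiableAt ℂ (fun z => halfWp q (q * z)) z :=
      (differentiableAt_halfWp hq (norm_mul_lt_one_of_lt_inv hq0 hz')).comp z
        (by fun_prop : DifferentiableAt ℂ (fun z => q * z) z)
    have h2 : DifferentiableAt ℂ (fun z => halfWp q (q / z)) z :=
      (differentiableAt_halfWp hq (norm_div_lt_one_of_lt hz)).comp z
        (by fun_prop (disch := assumption) : DifferentiableAt ℂ (fun z => q / z) z)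
    have h3 : DifferentiableAt ℂ (fun z => modTheta q (z * y)) z :=
      DifferentiableAt.comp z (g := modTheta q) (differentiableAt_modTheta hq (mul_ne_zero hz0 hy0))
        (by fun_prop : DifferentiableAt ℂ (fun z => z * y) z)
    have h4 : DifferentiableAt ℂ (fun z => modTheta q (z / y)) z :=
      DifferentiableAt.comp z (g := modTheta q) (differentiableAt_modTheta hq (div_ne_zero hz0 hy0))
        (by fun_prop : DifferentiableAt ℂ (fun z => z / y) z)
    have h5 : (qPoch q (q * z) * qPoch q (q / z)) ^ 2 ≠ 0 :=
      pow_ne_zero 2 (qPoch_mul_qPoch_ne_zero hq hq0 hz hz')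
    have h6 : DifferentiableAt ℂ (fun z => (qPoch q (q * z) * qPoch q (q / z)) ^ 2) z := by
      fun_prop (disch := assumption)
    exact (by fun_prop : DifferentiableAt ℂ (fun z => z + (1 - z) ^ 2 *
      (halfWp q (q * z) + halfWp q (q / z))) z).sub (((h3.mul h4).div h6 h5).const_mul c)
  have hg1 : g 1 = 0 := by
    have hθy' : modTheta q y⁻¹ ≠ 0 := by
      rw [modTheta_inv hq hy0]
      exact div_ne_zero (neg_ne_zero.2 hθy) hy0
    simp only [g, hc, mul_one, div_one, one_mul, one_div]
    field_simp
    simp [hθy']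
  have hK : ∀ z, ‖q‖ < ‖z‖ → ‖z‖ < ‖q‖⁻¹ → z ≠ 1 → K z = g z / (1 - z) ^ 2 := by
    intro z hz hz' hz1
    have h1 : 1 - z ≠ 0 := sub_ne_zero.2 hz1.symm
    have h2 := qPoch_mul_qPoch_ne_zero hq hq0 hz hz'
    simp only [K, g, mulWp_eq hq z, modTheta_eq hq z]
    set u := qPoch q (q * z) * qPoch q (q / z)
    field_simp
  have hKq : ∀ z, z ≠ 0 → K (q * z) = K z := by
    intro z hz
    simp only [K, mulWp_mul_left hq hq0, mul_assoc q z, mul_div_assoc q z,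
      modTheta_mul_left hq hq0 hz, modTheta_mul_left hq hq0 (mul_ne_zero hz hy0),
      modTheta_mul_left hq hq0 (div_ne_zero hz hy0)]
    field_simp
  have hKi : ∀ z, z ≠ 0 → K z⁻¹ = K z := by
    intro z hz
    have e1 : z⁻¹ * y = (z / y)⁻¹ := by field_simp
    have e2 : z⁻¹ / y = (z * y)⁻¹ := by field_simp
    simp only [K, mulWp_inv hq, e1, e2, modTheta_inv hq hz,
      modTheta_inv hq (mul_ne_zero hz hy0), modTheta_inv hq (div_ne_zero hz hy0)]
    field_simp
  have hKxy := eq_of_qPeriodic hq hq0 hg hg1 hK hKq hKi hx hx' hx1 hy hy' hy1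
  have hKy : K y = mulWp q y := by simp [K, div_self hy0, modTheta_one hq]
  rw [hKy] at hKxy
  simp only [K] at hKxy
  linear_combination hKxy

lemma summable_succ_mul_pow_mul {r : ℝ} (hr : ‖r‖ < 1) :
    Summable fun c : ℕ × ℕ => ((c.2 : ℝ) + 1) * r ^ ((c.1 + 1) * (c.2 + 1)) := by
  have h := summable_prod_mul_pow 1 hr
  rw [← (Equiv.pnatEquivNat.prodCongr Equiv.pnatEquivNat).symm.summable_iff] at h
  refine h.congr fun c => ?_
  simp

lemma hasSum_halfWp_mul (hq : ‖q‖ < 1) {w : ℂ} (hw : ‖w‖ ≤ 1) :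
    HasSum (fun m : ℕ => ((m : ℂ) + 1) * q ^ (m + 1) / (1 - q ^ (m + 1)) * w ^ (m + 1))
      (halfWp q (q * w)) := by
  have hqw : ‖q * w‖ < 1 := by
    rw [norm_mul]
    exact (mul_le_of_le_one_right (norm_nonneg _) hw).trans_lt hq
  have hs : Summable (Function.uncurry fun n m : ℕ =>
      ((m : ℂ) + 1) * (q * w * q ^ n) ^ (m + 1)) := by
    refine .of_norm_bounded (summable_succ_mul_pow_mul (r := ‖q‖) (by simpa using hq)) fun c => ?_
    have : ‖(c.2 : ℂ) + 1‖ = (c.2 : ℝ) + 1 := by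
      exact_mod_cast Complex.norm_natCast (c.2 + 1)
    rw [Function.uncurry, norm_mul, this, norm_pow, norm_mul, norm_mul, norm_pow, pow_mul]
    gcongr
    rw [pow_succ', mul_right_comm]
    exact mul_le_of_le_one_right (by positivity) hw
  have e1 (n : ℕ) : q * w * q ^ n / (1 - q * w * q ^ n) ^ 2 =
      ∑' m : ℕ, ((m : ℂ) + 1) * (q * w * q ^ n) ^ (m + 1) := by
    have hn := norm_mul_pow_lt_one hq hqw n
    rw [← tsum_coe_mul_geometric_of_norm_lt_one hn,
      (hasSum_coe_mul_geometric_of_norm_lt_one hn).summable.tsum_eq_zero_add]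
    simp
  have e2 (m : ℕ) : ((m : ℂ) + 1) * q ^ (m + 1) / (1 - q ^ (m + 1)) * w ^ (m + 1) =
      ∑' n : ℕ, ((m : ℂ) + 1) * (q * w * q ^ n) ^ (m + 1) := by
    have hm : ‖q ^ (m + 1)‖ < 1 := by
      rw [norm_pow]
      exact pow_lt_one₀ (norm_nonneg _) hq (by simp)
    have (n : ℕ) : ((m : ℂ) + 1) * (q * w * q ^ n) ^ (m + 1) =
        ((m : ℂ) + 1) * q ^ (m + 1) * w ^ (m + 1) * (q ^ (m + 1)) ^ n := by
      rw [mul_pow, mul_pow, pow_right_comm]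
      ring
    simp only [this, tsum_mul_left, tsum_geometric_of_norm_lt_one hm]
    ring
  rw [halfWp]
  simp only [e1, e2]
  rw [← hs.tsum_comm]
  exact hs.prod_symm.prod.hasSum

end

section FifthRoot

variable {q ζ : ℂ}

lemma div_one_sub_sq_of_fifth_root (hζ : 1 + ζ + ζ ^ 2 + ζ ^ 3 + ζ ^ 4 = 0) (h1 : ζ ≠ 1) :
    ζ / (1 - ζ) ^ 2 = (ζ ^ 2 + ζ ^ 3 - 2) / 5 := by
  rw [div_eq_iff (pow_ne_zero 2 (sub_ne_zero.2 h1.symm))]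
  linear_combination -(ζ - 2) / 5 * hζ

lemma pow_mod_five (h5 : ζ ^ 5 = 1) (n : ℕ) : ζ ^ n = ζ ^ (n % 5) := by
  conv_lhs => rw [← Nat.mod_add_div n 5, pow_add, pow_mul, h5, one_pow, mul_one]

lemma legendreSym_five_gauss [Fact (Nat.Prime 5)] (h5 : ζ ^ 5 = 1) (n : ℕ) :
    ζ ^ n + (ζ ^ 4) ^ n - (ζ ^ 2) ^ n - (ζ ^ 3) ^ n =
      (ζ - ζ ^ 2 - ζ ^ 3 + ζ ^ 4) * (legendreSym 5 n : ℂ) := by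
  simp only [← pow_mul]
  rw [pow_mod_five h5 n, pow_mod_five h5 (4 * n), pow_mod_five h5 (2 * n), pow_mod_five h5 (3 * n),
    Nat.mul_mod 4, Nat.mul_mod 2, Nat.mul_mod 3, legendreSym.mod]
  have hlt : n % 5 < 5 := Nat.mod_lt _ (by norm_num)
  have hcast : (n : ℤ) % (5 : ℕ) = ((n % 5 : ℕ) : ℤ) := by simp
  rw [hcast]
  generalize n % 5 = k at hlt
  have l0 : legendreSym 5 0 = 0 := by norm_num
  have l1 : legendreSym 5 1 = 1 := by norm_num
  have l2 : legendreSym 5 2 = -1 := by norm_num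
  have l3 : legendreSym 5 3 = -1 := by norm_num
  have l4 : legendreSym 5 4 = 1 := by norm_num
  interval_cases k <;> norm_num [l0, l1, l2, l3, l4] <;> ring

lemma qPoch_mul_fifth_roots (hq : ‖q‖ < 1) (hζ : 1 + ζ + ζ ^ 2 + ζ ^ 3 + ζ ^ 4 = 0) :
    qPoch q q * qPoch q (q * ζ) * qPoch q (q * ζ ^ 2) * qPoch q (q * ζ ^ 3) *
      qPoch q (q * ζ ^ 4) = qPoch (q ^ 5) (q ^ 5) := by
  have h5 : ζ ^ 5 = 1 := by linear_combination (ζ - 1) * hζ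
  have m := multipliable_qPoch hq
  simp only [qPoch]
  rw [← (m q).tprod_mul (m _), ← ((m q).mul (m _)).tprod_mul (m _),
    ← (((m q).mul (m _)).mul (m _)).tprod_mul (m _),
    ← ((((m q).mul (m _)).mul (m _)).mul (m _)).tprod_mul (m _)]
  refine tprod_congr fun n => ?_
  have : q ^ 5 * (q ^ 5) ^ n = (q * q ^ n) ^ 5 := by ring
  rw [this]
  have hz (z : ℂ) : (1 - z) * (1 - z * ζ) * (1 - z * ζ ^ 2) * (1 - z * ζ ^ 3) * (1 - z * ζ ^ 4) =
      1 - z ^ 5 := by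
    linear_combination (-z + 2 * z ^ 2 - 2 * z ^ 3 + ζ ^ 6 * z ^ 4) * hζ +
      ((2 + ζ + ζ ^ 2) * z ^ 2 - (ζ ^ 4 + ζ ^ 3 + 2 * ζ ^ 2 + 2 * ζ + 2) * z ^ 3 -
        (ζ ^ 5 + 1) * z ^ 5) * h5
  rw [← hz]
  ring

/-- The Lambert series form of `f(-q)⁵ / f(-q⁵)` for complex `q`. -/
theorem one_sub_five_mul_tsum_legendreSym [Fact (Nat.Prime 5)] (hq : ‖q‖ < 1) (hq0 : q ≠ 0) :
    (1 - 5 * ∑' n : ℕ, (legendreSym 5 (n + 1) : ℂ) *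
      (((n : ℂ) + 1) * q ^ (n + 1) / (1 - q ^ (n + 1)))) * qPoch (q ^ 5) (q ^ 5) =
      qPoch q q ^ 5 := by
  obtain ⟨ζ, hprim⟩ : ∃ ζ : ℂ, IsPrimitiveRoot ζ 5 :=
    ⟨_, Complex.isPrimitiveRoot_exp 5 (by norm_num)⟩
  have h5 : ζ ^ 5 = 1 := hprim.pow_eq_one
  have hne1 : ζ ≠ 1 := hprim.ne_one (by norm_num)
  have hne2 : ζ ^ 2 ≠ 1 := hprim.pow_ne_one_of_pos_of_lt (by norm_num) (by norm_num)
  have hζ0 : ζ ≠ 0 := hprim.ne_zero (by norm_num)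
  have hζ : 1 + ζ + ζ ^ 2 + ζ ^ 3 + ζ ^ 4 = 0 := by
    refine mul_left_cancel₀ (sub_ne_zero.2 hne1) ?_
    linear_combination h5
  have hζ2 : 1 + ζ ^ 2 + (ζ ^ 2) ^ 2 + (ζ ^ 2) ^ 3 + (ζ ^ 2) ^ 4 = 0 := by
    linear_combination hζ + (ζ + ζ ^ 3) * h5
  have hn : ‖ζ‖ = 1 := hprim.norm'_eq_one (by norm_num)
  have hinv : ζ⁻¹ = ζ ^ 4 := inv_eq_of_mul_eq_one_right (by rw [← h5]; ring)
  have hinv2 : (ζ ^ 2)⁻¹ = ζ ^ 3 := by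
    rw [← inv_pow, hinv]
    linear_combination ζ ^ 3 * h5
  have hr1 : 1 < ‖q‖⁻¹ := (one_lt_inv₀ (norm_pos_iff.2 hq0)).2 hq
  have hann (k : ℕ) : ‖q‖ < ‖ζ ^ k‖ ∧ ‖ζ ^ k‖ < ‖q‖⁻¹ := by simp [hn, hq, hr1]
  have hs (k : ℕ) := hasSum_halfWp_mul hq (w := ζ ^ k) (by simp [hn])
  set s := ζ - ζ ^ 2 - ζ ^ 3 + ζ ^ 4 with hs_def
  have hs5 : s ^ 2 = 5 := by
    linear_combination -hζ + (4 - ζ - 2 * ζ ^ 2 + ζ ^ 3) * h5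
  set S := ∑' n : ℕ, (legendreSym 5 (n + 1) : ℂ) *
      (((n : ℂ) + 1) * q ^ (n + 1) / (1 - q ^ (n + 1)))
  have hW : mulWp q ζ - mulWp q (ζ ^ 2) = -s / 5 + s * S := by
    have hsum := (((hs 1).add (hs 4)).sub (hs 2)).sub (hs 3)
    have hterm : ∀ n : ℕ, s * ((legendreSym 5 (n + 1) : ℂ) *
        (((n : ℂ) + 1) * q ^ (n + 1) / (1 - q ^ (n + 1)))) =
        ((n : ℂ) + 1) * q ^ (n + 1) / (1 - q ^ (n + 1)) * (ζ ^ 1) ^ (n + 1) +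
        ((n : ℂ) + 1) * q ^ (n + 1) / (1 - q ^ (n + 1)) * (ζ ^ 4) ^ (n + 1) -
        ((n : ℂ) + 1) * q ^ (n + 1) / (1 - q ^ (n + 1)) * (ζ ^ 2) ^ (n + 1) -
        ((n : ℂ) + 1) * q ^ (n + 1) / (1 - q ^ (n + 1)) * (ζ ^ 3) ^ (n + 1) := by
      intro n
      have := legendreSym_five_gauss h5 (n + 1)
      push_cast at this
      rw [pow_one]
      linear_combination -((n : ℂ) + 1) * q ^ (n + 1) / (1 - q ^ (n + 1)) * this
    rw [← tsum_mul_left, tsum_congr hterm, hsum.tsum_eq, mulWp_eq hq, mulWp_eq hq,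
      div_eq_mul_inv q ζ, div_eq_mul_inv q (ζ ^ 2), hinv, hinv2,
      div_one_sub_sq_of_fifth_root hζ hne1, div_one_sub_sq_of_fifth_root hζ2 hne2, pow_one]
    linear_combination -ζ / 5 * h5
  have hP : modTheta q ζ * modTheta q (ζ ^ 2) * qPoch q q =
      (1 - ζ) * (1 - ζ ^ 2) * qPoch (q ^ 5) (q ^ 5) := by
    rw [← qPoch_mul_fifth_roots hq hζ, modTheta_eq hq, modTheta_eq hq,
      div_eq_mul_inv q ζ, div_eq_mul_inv q (ζ ^ 2), hinv, hinv2]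
    ring
  have hθ1 : modTheta q ζ ≠ 0 :=
    modTheta_ne_zero hq hq0 (by simpa using (hann 1).1) (by simpa using (hann 1).2) hne1
  have hθ2 : modTheta q (ζ ^ 2) ≠ 0 := modTheta_ne_zero hq hq0 (hann 2).1 (hann 2).2 hne2
  have hθ3 : modTheta q (ζ ^ 3) ≠ 0 := modTheta_ne_zero hq hq0 (hann 3).1 (hann 3).2
    (hprim.pow_ne_one_of_pos_of_lt (by norm_num) (by norm_num))
  have hid := mulWp_sub_mulWp hq hq0 (x := ζ) (y := ζ ^ 2) (by simpa using (hann 1).1)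
    (by simpa using (hann 1).2) hne1 (hann 2).1 (hann 2).2 hne2
  have e1 : ζ * ζ ^ 2 = ζ ^ 3 := by ring
  have e2 : ζ / ζ ^ 2 = ζ⁻¹ := by field_simp
  rw [hW, hinv2, e1, e2, modTheta_inv hq hζ0] at hid
  have hid' : (-s / 5 + s * S) * (ζ * (modTheta q ζ * modTheta q (ζ ^ 2))) = -qPoch q q ^ 4 := by
    rw [hid]
    field_simp
  linear_combination -qPoch q q * hid' + (-s / 5 + s * S) * ζ * hP -
    (1 - 5 * S) / 5 * qPoch (q ^ 5) (q ^ 5) * hs5 -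
    (-s / 5 + s * S) * qPoch (q ^ 5) (q ^ 5) * hs_def

end FifthRoot

lemma ofReal_ramanujanF_s6 {q : ℝ} (hq : |q| < 1) : (ramanujanF q : ℂ) = qPoch q q := by
  have hm : Multipliable fun n : ℕ => 1 - q ^ (n + 1) := by
    simpa [sub_eq_add_neg] using multipliable_one_add_of_summable (f := fun n : ℕ => -q ^ (n + 1))
      (by simpa using (summable_nat_add_iff 1).2 (summable_geometric_of_lt_one (abs_nonneg q) hq))
  have h := hm.map_tprod Complex.ofRealHom Complex.continuous_ofReal
  rw [Complex.ofRealHom_eq_coe] at h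
  rw [ramanujanF, qPoch, h]
  refine tprod_congr fun n => ?_
  simp [pow_succ']

lemma ramanujanF_ne_zero {q : ℝ} (hq : |q| < 1) : ramanujanF q ≠ 0 := by
  have hq' : ‖(q : ℂ)‖ < 1 := by simpa using hq
  exact_mod_cast (ofReal_ramanujanF_s6 hq).trans_ne (qPoch_ne_zero_of_norm_lt_one hq' hq')

lemma one_sub_five_mul_tsum_eq_ramanujanF [Fact (Nat.Prime 5)] {q : ℝ} (hq0 : 0 < q)
    (hq1 : q < 1) :
    1 - 5 * ∑' n : ℕ, (legendreSym 5 (n + 1) : ℝ) *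
      (((n : ℝ) + 1) * q ^ (n + 1) / (1 - q ^ (n + 1))) =
      ramanujanF q ^ 5 / ramanujanF (q ^ 5) := by
  have hq : |q| < 1 := by rwa [abs_of_pos hq0]
  have hq5 : |q ^ 5| < 1 := by
    rw [abs_pow]
    exact pow_lt_one₀ (abs_nonneg q) hq (by norm_num)
  rw [eq_div_iff (ramanujanF_ne_zero hq5)]
  have h := one_sub_five_mul_tsum_legendreSym (q := q) (by simpa using hq)
    (by exact_mod_cast hq0.ne')
  rw [← ofReal_ramanujanF_s6 hq, ← Complex.ofReal_pow, ← ofReal_ramanujanF_s6 hq5] at h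
  exact_mod_cast h

lemma abs_legendreSym_five_le [Fact (Nat.Prime 5)] (a : ℤ) : |(legendreSym 5 a : ℝ)| ≤ 1 := by
  rcases eq_or_ne (a : ZMod 5) 0 with h | h
  · simp [(legendreSym.eq_zero_iff 5 a).2 h]
  · rcases legendreSym.eq_one_or_neg_one 5 h with h | h <;> simp [h]

lemma summable_legendreSym_mul_log [Fact (Nat.Prime 5)] {x : ℝ} (hx0 : 0 < x) (hx1 : x < 1) :
    Summable fun n : ℕ => (legendreSym 5 (n + 1) : ℝ) * Real.log (1 - x ^ (n + 1)) := by
  have hs : Summable fun n : ℕ => -x ^ (n + 1) :=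
    ((summable_nat_add_iff 1).2 (summable_geometric_of_lt_one hx0.le hx1)).neg
  have hl := (Real.summable_log_one_add_of_summable hs).abs
  refine .of_norm_bounded hl fun n => ?_
  rw [norm_mul, Real.norm_eq_abs, Real.norm_eq_abs, ← sub_eq_add_neg]
  exact mul_le_of_le_one_left (abs_nonneg _) (abs_legendreSym_five_le _)

lemma rogersRamanujan_eq_exp [Fact (Nat.Prime 5)] {x : ℝ} (hx0 : 0 < x) (hx1 : x < 1) :
    rogersRamanujan x = Real.exp (1 / 5 * Real.log x +
      ∑' n : ℕ, (legendreSym 5 (n + 1) : ℝ) * Real.log (1 - x ^ (n + 1))) := by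
  have hpos (n : ℕ) : 0 < 1 - x ^ (n + 1) := by
    have := pow_lt_one₀ hx0.le hx1 (Nat.succ_ne_zero n)
    simpa using this
  rw [rogersRamanujan, Real.exp_add, Real.rpow_def_of_pos hx0, mul_comm (Real.log x)]
  congr 1
  simp only [← Real.log_zpow]
  rw [Real.rexp_tsum_eq_tprod (fun n => zpow_pos (hpos n) _)
    (by simpa only [Real.log_zpow] using summable_legendreSym_mul_log hx0 hx1)]

lemma hasDerivAt_tsum_legendreSym_mul_log [Fact (Nat.Prime 5)] {q : ℝ} (hq0 : 0 < q)
    (hq1 : q < 1) :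
    HasDerivAt
      (fun x : ℝ => ∑' n : ℕ, (legendreSym 5 (n + 1) : ℝ) * Real.log (1 - x ^ (n + 1)))
      (∑' n : ℕ, (legendreSym 5 (n + 1) : ℝ) * (-(((n : ℝ) + 1) * q ^ n) / (1 - q ^ (n + 1)))) q := by
  obtain ⟨r, hqr, hr⟩ := exists_between hq1
  have hr0 : 0 < r := hq0.trans hqr
  have hpow (x : ℝ) (hx : x ∈ Set.Ioo 0 r) (n : ℕ) : x ^ (n + 1) ≤ r :=
    (pow_le_of_le_one hx.1.le (hx.2.trans hr).le n.succ_ne_zero).trans hx.2.le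
  have hu : Summable fun n : ℕ => ((n : ℝ) + 1) * r ^ n / (1 - r) := by
    refine Summable.div_const ?_ _
    have h1 := summable_pow_mul_geometric_of_norm_lt_one 1
      (by rwa [Real.norm_of_nonneg hr0.le] : ‖r‖ < 1)
    have h2 := summable_geometric_of_lt_one hr0.le hr
    simpa [add_mul] using h1.add h2
  refine hasDerivAt_tsum_of_isPreconnected
    (g := fun (n : ℕ) (x : ℝ) => (legendreSym 5 (n + 1) : ℝ) * Real.log (1 - x ^ (n + 1)))
    (g' := fun (n : ℕ) (x : ℝ) =>
      (legendreSym 5 (n + 1) : ℝ) * (-(((n : ℝ) + 1) * x ^ n) / (1 - x ^ (n + 1))))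
    hu isOpen_Ioo isPreconnected_Ioo
    (fun n x hx => ?_) (fun n x hx => ?_) ⟨hq0, hqr⟩ (summable_legendreSym_mul_log hq0 hq1)
    ⟨hq0, hqr⟩
  · have h := hpow x hx n
    have hd := ((hasDerivAt_pow (n + 1) x).const_sub 1).log (by linarith)
    refine (hd.const_mul _).congr_deriv ?_
    simp
  · have h := hpow x hx n
    have hx0 := hx.1
    have hx1 := hx.2
    have h1 : 0 < 1 - r := by linarith
    have h2 : 0 < 1 - x ^ (n + 1) := by linarith
    rw [norm_mul, norm_div, norm_neg, Real.norm_of_nonneg h2.le,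
      Real.norm_of_nonneg (by positivity : 0 ≤ ((n : ℝ) + 1) * x ^ n)]
    refine (mul_le_of_le_one_left (by positivity) (abs_legendreSym_five_le _)).trans ?_
    gcongr

/-- `R'(q)/R(q) = f(-q)⁵ / (5 q f(-q⁵))` for `0 < q < 1`. -/
theorem rogersRamanujan_log_deriv (q : ℝ) (hq0 : 0 < q) (hq1 : q < 1) :
    deriv rogersRamanujan q / rogersRamanujan q =
      (ramanujanF q) ^ 5 / (5 * q * ramanujanF (q ^ 5)) := by
  have : Fact (Nat.Prime 5) := ⟨by norm_num⟩
  have hd := (((Real.hasDerivAt_log hq0.ne').const_mul (1 / 5)).fun_add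
    (hasDerivAt_tsum_legendreSym_mul_log hq0 hq1)).exp
  have heq : rogersRamanujan =ᶠ[𝓝 q] fun x => Real.exp (1 / 5 * Real.log x +
      ∑' n : ℕ, (legendreSym 5 (n + 1) : ℝ) * Real.log (1 - x ^ (n + 1))) := by
    filter_upwards [isOpen_Ioo.mem_nhds ⟨hq0, hq1⟩] with x hx
    exact rogersRamanujan_eq_exp hx.1 hx.2
  have hterm (n : ℕ) : (legendreSym 5 (n + 1) : ℝ) *
      (-(((n : ℝ) + 1) * q ^ n) / (1 - q ^ (n + 1))) =
      -q⁻¹ * ((legendreSym 5 (n + 1) : ℝ) *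
        (((n : ℝ) + 1) * q ^ (n + 1) / (1 - q ^ (n + 1)))) := by
    rw [pow_succ]
    field_simp
  rw [(hd.congr_of_eventuallyEq heq).deriv, rogersRamanujan_eq_exp hq0 hq1,
    mul_div_cancel_left₀ _ (Real.exp_ne_zero _), tsum_congr hterm, tsum_mul_left,
    mul_comm (5 * q), ← div_div, ← one_sub_five_mul_tsum_eq_ramanujanF hq0 hq1]
  field_simp
  ring
end
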